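/- arXiv:1911.01564 — 3 statements merged into one kernel-verified Lean document; each statement's English description precedes it below -/
import Mathlib

section
/- Let k ≥ 2 and let (Σ_k, σ) be the k-symbol full shift. Then for each i = 1,…,6, the set {x ∈ Rec(Σ_k) \ BR(Σ_k) : x satisfies Case (i')} is dense in Σ_k and contains an uncountable DC1-scrambled subset. -/
open Filter Topology MeasureTheory

/-- Upper density of a set of naturals. -/
noncomputable def upperDensity (S : Set ℕ) : ℝ :=
  Filter.limsup (fun n => ((S ∩ Set.Iio n).ncard : ℝ) / n) Filter.atTop

/-- Lower density of a set of naturals. -/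
noncomputable def lowerDensity (S : Set ℕ) : ℝ :=
  Filter.liminf (fun n => ((S ∩ Set.Iio n).ncard : ℝ) / n) Filter.atTop

/-- Banach upper density: limsup over the interval length of the maximal
proportion of `S` in an interval of that length. -/
noncomputable def banachUpperDensity (S : Set ℕ) : ℝ :=
  Filter.limsup (fun N => ⨆ a : ℕ, ((S ∩ Set.Ico a (a + N)).ncard : ℝ) / N) Filter.atTop

/-- Banach lower density. -/
noncomputable def banachLowerDensity (S : Set ℕ) : ℝ :=
  Filter.liminf (fun N => ⨅ a : ℕ, ((S ∩ Set.Ico a (a + N)).ncard : ℝ) / N) Filter.atTop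

/-- The shift map on the full shift `Σ_k = {0, …, k-1}^ℕ`. -/
def shift {k : ℕ} (x : ℕ → Fin k) : ℕ → Fin k := fun n => x (n + 1)

/-- The metric `d(x,y) = Σ_{n ≥ 1} δ(x_n, y_n)/2^n` on `Σ_k` (sequences indexed from `0`). -/
noncomputable def shiftDist {k : ℕ} (x y : ℕ → Fin k) : ℝ :=
  ∑' n : ℕ, if x n = y n then 0 else (1 / 2) ^ (n + 1)

/-- The open ball `B_ε(x)` for the metric `shiftDist`. -/
def sball {k : ℕ} (x : ℕ → Fin k) (ε : ℝ) : Set (ℕ → Fin k) := {y | shiftDist x y < ε}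

/-- `N(x, U) = {n ≥ 1 : σ^n(x) ∈ U}`. -/
def visits {k : ℕ} (x : ℕ → Fin k) (U : Set (ℕ → Fin k)) : Set ℕ :=
  {n | 1 ≤ n ∧ shift^[n] x ∈ U}

/-- A point is recurrent if `N(x, B_ε(x)) ≠ ∅` for every `ε > 0`. -/
def Recurrent {k : ℕ} (x : ℕ → Fin k) : Prop := ∀ ε > (0 : ℝ), (visits x (sball x ε)).Nonempty

/-- A point is Banach recurrent if `N(x, B_ε(x))` has positive Banach upper density
for every `ε > 0`. -/
def BanachRecurrent {k : ℕ} (x : ℕ → Fin k) : Prop :=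
  ∀ ε > (0 : ℝ), 0 < banachUpperDensity (visits x (sball x ε))

/-- Statistical ω-limit set w.r.t. a density notion `ξ`:
`ω_ξ(x) = {y : ξ(N(x, B_ε(y))) > 0 for all ε > 0}`. -/
def statOmega {k : ℕ} (ξ : Set ℕ → ℝ) (x : ℕ → Fin k) : Set (ℕ → Fin k) :=
  {y | ∀ ε > (0 : ℝ), 0 < ξ (visits x (sball y ε))}

/-- The usual ω-limit set of `x` under the shift. -/
def omegaLim {k : ℕ} (x : ℕ → Fin k) : Set (ℕ → Fin k) :=
  {y | ∀ ε > (0 : ℝ), ∀ N : ℕ, ∃ n ≥ N, shift^[n] x ∈ sball y ε}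

/-- Density of a subset of `Σ_k` w.r.t. the metric `shiftDist`. -/
def ShiftDense {k : ℕ} (A : Set (ℕ → Fin k)) : Prop :=
  ∀ x : ℕ → Fin k, ∀ ε > (0 : ℝ), ∃ y ∈ A, shiftDist x y < ε

/-- Closure of a subset of `Σ_k` w.r.t. the metric `shiftDist`. -/
def shiftClosure {k : ℕ} (A : Set (ℕ → Fin k)) : Set (ℕ → Fin k) :=
  {z | ∀ ε > (0 : ℝ), ∃ y ∈ A, shiftDist z y < ε}

/-- `Φ^{(n)}_{xy}(t)`: the proportion of times `0 ≤ i < n` with `d(σ^i x, σ^i y) < t`. -/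
noncomputable def PhiN {k : ℕ} (x y : ℕ → Fin k) (n : ℕ) (t : ℝ) : ℝ :=
  (({i | i < n ∧ shiftDist (shift^[i] x) (shift^[i] y) < t}).ncard : ℝ) / n

/-- A pair is DC1 (distributionally chaotic of type 1) if `Φ_{xy}(s) = 0` for some `s > 0`
and `Φ*_{xy}(t) = 1` for all `t > 0`. -/
def DC1Pair {k : ℕ} (x y : ℕ → Fin k) : Prop :=
  (∃ s > (0 : ℝ), Filter.liminf (fun n => PhiN x y n s) Filter.atTop = 0) ∧
  (∀ t > (0 : ℝ), Filter.limsup (fun n => PhiN x y n t) Filter.atTop = 1)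

/-- A set with at least two points is DC1-scrambled if every pair of distinct points is DC1. -/
def DC1Scrambled {k : ℕ} (S : Set (ℕ → Fin k)) : Prop :=
  S.Nontrivial ∧ ∀ x ∈ S, ∀ y ∈ S, x ≠ y → DC1Pair x y

/-- `strictOrEq true A B` means `A ⊊ B`; `strictOrEq false A B` means `A = B`. -/
def strictOrEq {α : Type*} (b : Bool) (A B : Set α) : Prop := if b then A ⊂ B else A = B

/-- The patterns of (strict ⊊ = `true` / equality = `false`) for the three inclusions
`ω_{B_*} ⊆ ω_{d̲} ⊆ ω_{d̄} ⊆ ω_{B*}` in Cases (1)–(6). -/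
def caseFlags : Fin 6 → Bool × Bool × Bool :=
  ![(true, false, false), (true, false, true), (false, true, false),
    (true, true, false), (false, true, true), (true, true, true)]

/-- `x` satisfies Case (i), i = 1,…,6: the chain
`ω_{B_*}(x) ⊆ ω_{d̲}(x) ⊆ ω_{d̄}(x) ⊆ ω_{B*}(x) = ω_σ(x)` with strictness pattern given by
`caseFlags i`, and the last inclusion an equality. -/
def SatCase {k : ℕ} (i : Fin 6) (x : ℕ → Fin k) : Prop :=
  strictOrEq (caseFlags i).1 (statOmega banachLowerDensity x) (statOmega lowerDensity x) ∧
  strictOrEq (caseFlags i).2.1 (statOmega lowerDensity x) (statOmega upperDensity x) ∧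
  strictOrEq (caseFlags i).2.2 (statOmega upperDensity x) (statOmega banachUpperDensity x) ∧
  statOmega banachUpperDensity x = omegaLim x

/-- `x` satisfies Case (i'), i = 1,…,6: as in Case (i) but the last inclusion
`ω_{B*}(x) ⊆ ω_σ(x)` is strict. -/
def SatCase' {k : ℕ} (i : Fin 6) (x : ℕ → Fin k) : Prop :=
  strictOrEq (caseFlags i).1 (statOmega banachLowerDensity x) (statOmega lowerDensity x) ∧
  strictOrEq (caseFlags i).2.1 (statOmega lowerDensity x) (statOmega upperDensity x) ∧
  strictOrEq (caseFlags i).2.2 (statOmega upperDensity x) (statOmega banachUpperDensity x) ∧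
  statOmega banachUpperDensity x ⊂ omegaLim x


/-! ### Counting -/

noncomputable def cnt (S : Set ℕ) (a b : ℕ) : ℕ := (S ∩ Set.Ico a b).ncard

lemma cnt_fin (S : Set ℕ) (a b : ℕ) : (S ∩ Set.Ico a b).Finite :=
  (Set.finite_Ico a b).inter_of_right S

lemma cnt_mono {S S' : Set ℕ} {a b a' b' : ℕ} (ha : a' ≤ a) (hb : b ≤ b')
    (h : ∀ n, a ≤ n → n < b → n ∈ S → n ∈ S') : cnt S a b ≤ cnt S' a' b' := by
  apply Set.ncard_le_ncard _ (cnt_fin _ _ _)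
  rintro n ⟨h1, h2, h3⟩
  exact ⟨h n h2 h3 h1, by omega, by omega⟩

lemma cnt_le (S : Set ℕ) (a b : ℕ) : cnt S a b ≤ b - a := by
  have : cnt S a b ≤ (Set.Ico a b).ncard :=
    Set.ncard_le_ncard Set.inter_subset_right (Set.finite_Ico a b)
  rwa [Set.ncard_eq_toFinset_card', Set.toFinset_Ico, Nat.card_Ico] at this

lemma cnt_full {S : Set ℕ} {a b : ℕ} (h : ∀ n, a ≤ n → n < b → n ∈ S) : cnt S a b = b - a := by
  have : S ∩ Set.Ico a b = Set.Ico a b := by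
    ext n; simp only [Set.mem_inter_iff, Set.mem_Ico]
    exact ⟨fun h => h.2, fun h' => ⟨h n h'.1 h'.2, h'⟩⟩
  rw [cnt, this, Set.ncard_eq_toFinset_card', Set.toFinset_Ico, Nat.card_Ico]

lemma cnt_empty {S : Set ℕ} {a b : ℕ} (h : ∀ n, a ≤ n → n < b → n ∉ S) : cnt S a b = 0 := by
  have : S ∩ Set.Ico a b = ∅ := by
    ext n; simp only [Set.mem_inter_iff, Set.mem_Ico, Set.mem_empty_iff_false, iff_false]
    exact fun h' => h n h'.2.1 h'.2.2 h'.1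
  rw [cnt, this, Set.ncard_empty]

lemma cnt_split (S : Set ℕ) (a b c : ℕ) : cnt S a c ≤ cnt S a b + cnt S b c := by
  refine le_trans (Set.ncard_le_ncard ?_ ((cnt_fin S a b).union (cnt_fin S b c)))
    (Set.ncard_union_le _ _)
  rintro n ⟨h1, h2, h3⟩
  by_cases h : n < b
  · exact Or.inl ⟨h1, h2, h⟩
  · exact Or.inr ⟨h1, not_lt.1 h, h3⟩

lemma cnt_add (S : Set ℕ) {a b c : ℕ} (h1 : a ≤ b) (h2 : b ≤ c) :
    cnt S a b + cnt S b c = cnt S a c := by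
  unfold cnt
  rw [← Set.ncard_union_eq _ (cnt_fin S a b) (cnt_fin S b c)]
  · congr 1
    rw [← Set.inter_union_distrib_left, Set.Ico_union_Ico_eq_Ico h1 h2]
  · rw [Set.disjoint_left]
    rintro n ⟨_, h3⟩ ⟨_, h4⟩
    simp only [Set.mem_Ico] at h3 h4
    omega

lemma cnt_union (S S' : Set ℕ) (a b : ℕ) : cnt (S ∪ S') a b ≤ cnt S a b + cnt S' a b := by
  unfold cnt
  rw [Set.union_inter_distrib_right]
  exact Set.ncard_union_le _ _

lemma cnt_shift {S S' : Set ℕ} {a b d : ℕ} (hd : d ≤ a)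
    (h : ∀ n, a ≤ n → n < b → n ∈ S → n - d ∈ S') : cnt S a b ≤ cnt S' (a - d) (b - d) := by
  apply Set.ncard_le_ncard_of_injOn (fun n => n - d) _ _ (cnt_fin _ _ _)
  · rintro n ⟨h1, h2, h3⟩
    exact ⟨h n h2 h3 h1, by omega, by omega⟩
  · rintro n ⟨h1, h2, h3⟩ m ⟨h4, h5, h6⟩ h
    simp only at h
    omega

lemma cnt_shift' {S S' : Set ℕ} {a b d : ℕ}
    (h : ∀ n, a ≤ n → n < b → n ∈ S → n + d ∈ S') : cnt S a b ≤ cnt S' (a + d) (b + d) := by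
  apply Set.ncard_le_ncard_of_injOn (fun n => n + d) _ _ (cnt_fin _ _ _)
  · rintro n ⟨h1, h2, h3⟩
    exact ⟨h n h2 h3 h1, by omega, by omega⟩
  · rintro n ⟨h1, h2, h3⟩ m ⟨h4, h5, h6⟩ h
    simp only at h
    omega

/-! ### Null sets -/

def UNull (S : Set ℕ) : Prop := ∀ ε > (0 : ℝ), ∀ᶠ n : ℕ in atTop, (cnt S 0 n : ℝ) ≤ ε * n

def BNull (S : Set ℕ) : Prop :=
  ∀ ε > (0 : ℝ), ∃ C : ℝ, ∀ a N : ℕ, (cnt S a (a + N) : ℝ) ≤ ε * N + C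

lemma ev_mul {ε : ℝ} (hε : 0 < ε) (C : ℝ) : ∀ᶠ n : ℕ in atTop, C ≤ ε * n := by
  filter_upwards [(tendsto_natCast_atTop_atTop (R := ℝ)).eventually_ge_atTop (C / ε)] with n hn
  rw [div_le_iff₀ hε] at hn
  linarith

lemma BNull.uNull {S : Set ℕ} (h : BNull S) : UNull S := by
  intro ε hε
  obtain ⟨C, hC⟩ := h (ε / 2) (by linarith)
  filter_upwards [ev_mul (half_pos hε) C] with n hn
  have := hC 0 n
  rw [zero_add] at this
  linarith

lemma UNull.mono {S S' : Set ℕ} (h : UNull S') (hs : S ⊆ S') : UNull S := by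
  intro ε hε
  filter_upwards [h ε hε] with n hn
  refine le_trans ?_ hn
  exact_mod_cast cnt_mono le_rfl le_rfl (fun n _ _ h => hs h)

lemma BNull.mono {S S' : Set ℕ} (h : BNull S') (hs : S ⊆ S') : BNull S := by
  intro ε hε
  obtain ⟨C, hC⟩ := h ε hε
  refine ⟨C, fun a N => le_trans ?_ (hC a N)⟩
  exact_mod_cast cnt_mono le_rfl le_rfl (fun n _ _ h => hs h)

lemma UNull.union {S S' : Set ℕ} (h : UNull S) (h' : UNull S') : UNull (S ∪ S') := by
  intro ε hε
  filter_upwards [h (ε / 2) (by linarith), h' (ε / 2) (by linarith)] with n hn hn'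
  have : (cnt (S ∪ S') 0 n : ℝ) ≤ cnt S 0 n + cnt S' 0 n := by exact_mod_cast cnt_union S S' 0 n
  linarith

lemma UNull.shift {S : Set ℕ} (h : UNull S) (i : ℕ) : UNull {n | n + i ∈ S} := by
  intro ε hε
  filter_upwards [(tendsto_add_atTop_nat i).eventually (h (ε / 2) (by linarith)),
    ev_mul (half_pos hε) (ε / 2 * i)] with n hn hn'
  have : (cnt {n | n + i ∈ S} 0 n : ℝ) ≤ cnt S 0 (n + i) := by
    have h1 := cnt_shift' (S := {n | n + i ∈ S}) (S' := S) (a := 0) (b := n) (d := i)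
      (fun n _ _ h => h)
    have h2 := cnt_mono (S := S) (S' := S) (a := 0 + i) (a' := 0) (b := n + i) (b' := n + i)
      (by omega) le_rfl (fun n _ _ h => h)
    exact_mod_cast h1.trans h2
  push_cast at hn
  linarith

lemma UNull.empty : UNull ∅ := by
  intro ε hε
  filter_upwards with n
  rw [cnt_empty (by simp)]
  push_cast
  positivity

lemma UNull.window {S : Set ℕ} (h : UNull S) (L : ℕ) : UNull {n | ∃ i < L, n + i ∈ S} := by
  induction L with
  | zero => exact UNull.empty.mono (by simp)
  | succ L ih =>
    refine (ih.union (h.shift L)).mono ?_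
    rintro n ⟨i, hi, h⟩
    rcases Nat.lt_succ_iff_lt_or_eq.1 hi with h' | rfl
    · exact Or.inl ⟨i, h', h⟩
    · exact Or.inr h

lemma bNull_of_window {S : Set ℕ}
    (h : ∀ ε > (0 : ℝ), ∃ P : ℕ, 0 < P ∧ ∀ a, (cnt S a (a + P) : ℝ) ≤ ε * P) : BNull S := by
  intro ε hε
  obtain ⟨P, hP, h⟩ := h ε hε
  have key : ∀ q a : ℕ, (cnt S a (a + q * P) : ℝ) ≤ ε * (q * P) := by
    intro q
    induction q with
    | zero => intro a; simp [cnt]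
    | succ q ih =>
      intro a
      have h1 : (cnt S a (a + (q + 1) * P) : ℝ) ≤
          cnt S a (a + P) + cnt S (a + P) (a + (q + 1) * P) := by
        exact_mod_cast cnt_split S _ _ _
      have h2 := ih (a + P)
      rw [show a + P + q * P = a + (q + 1) * P by ring] at h2
      have h3 := h a
      push_cast
      nlinarith
  refine ⟨P, fun a N => ?_⟩
  have e : N / P * P + N % P = N := by rw [mul_comm]; exact Nat.div_add_mod N P
  have h1 : (cnt S a (a + N) : ℝ) ≤ cnt S a (a + N / P * P) + cnt S (a + N / P * P) (a + N) := by
    exact_mod_cast cnt_split S _ _ _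
  have h2 := key (N / P) a
  have h3 : (cnt S (a + N / P * P) (a + N) : ℝ) ≤ P := by
    have := cnt_le S (a + N / P * P) (a + N)
    have h4 := Nat.mod_lt N hP
    exact_mod_cast (show cnt S (a + N / P * P) (a + N) ≤ P by omega)
  have h5 : ((N / P : ℕ) * P : ℝ) ≤ N := by
    exact_mod_cast (show N / P * P ≤ N by omega)
  nlinarith

/-! ### liminf / limsup of bounded sequences -/

lemma ls_zero {u : ℕ → ℝ} (h0 : ∀ n, 0 ≤ u n) (h : ∀ ε > (0 : ℝ), ∀ᶠ n in atTop, u n ≤ ε) :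
    limsup u atTop = 0 := by
  apply Tendsto.limsup_eq
  rw [Metric.tendsto_nhds]
  intro ε hε
  filter_upwards [h (ε / 2) (by linarith)] with n hn
  rw [Real.dist_eq, sub_zero, abs_of_nonneg (h0 n)]
  linarith

lemma bdd_le {u : ℕ → ℝ} (h1 : ∀ n, u n ≤ 1) : IsBoundedUnder (· ≤ ·) atTop u :=
  isBoundedUnder_of ⟨1, h1⟩

lemma bdd_ge {u : ℕ → ℝ} (h0 : ∀ n, 0 ≤ u n) : IsBoundedUnder (· ≥ ·) atTop u :=
  isBoundedUnder_of ⟨0, h0⟩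

lemma ls_ge {u : ℕ → ℝ} (h1 : ∀ n, u n ≤ 1) {c : ℝ}
    (h : ∃ᶠ n in atTop, c ≤ u n) : c ≤ limsup u atTop :=
  le_limsup_of_frequently_le h (bdd_le h1)

lemma li_le {u : ℕ → ℝ} (h0 : ∀ n, 0 ≤ u n) {c : ℝ}
    (h : ∃ᶠ n in atTop, u n ≤ c) : liminf u atTop ≤ c :=
  liminf_le_of_frequently_le h (bdd_ge h0)

lemma li_ge {u : ℕ → ℝ} (h1 : ∀ n, u n ≤ 1) {c : ℝ}
    (h : ∀ᶠ n in atTop, c ≤ u n) : c ≤ liminf u atTop :=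
  le_liminf_of_le (bdd_le h1).isCoboundedUnder_ge h

lemma ls_one {u : ℕ → ℝ} (h0 : ∀ n, 0 ≤ u n) (h1 : ∀ n, u n ≤ 1)
    (h : ∀ ε > (0 : ℝ), ∃ᶠ n in atTop, 1 - ε ≤ u n) : limsup u atTop = 1 := by
  apply le_antisymm
  · exact limsup_le_of_le (bdd_ge h0).isCoboundedUnder_le (Eventually.of_forall h1)
  · apply le_of_forall_pos_le_add
    intro ε hε
    have := ls_ge h1 (h ε hε)
    linarith

lemma li_zero {u : ℕ → ℝ} (h0 : ∀ n, 0 ≤ u n) (h1 : ∀ n, u n ≤ 1)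
    (h : ∀ ε > (0 : ℝ), ∃ᶠ n in atTop, u n ≤ ε) : liminf u atTop = 0 := by
  apply le_antisymm
  · apply le_of_forall_pos_le_add
    intro ε hε
    have := li_le h0 (h ε hε)
    linarith
  · exact li_ge h1 (Eventually.of_forall h0)

/-! ### Densities -/

lemma frac_nonneg (S : Set ℕ) (a N : ℕ) : 0 ≤ (cnt S a (a + N) : ℝ) / N := by positivity

lemma frac_le_one (S : Set ℕ) (a N : ℕ) : (cnt S a (a + N) : ℝ) / N ≤ 1 := by
  apply div_le_one_of_le₀ _ (by positivity)
  have := cnt_le S a (a + N)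
  exact_mod_cast (show cnt S a (a + N) ≤ N by omega)

lemma Iio_cnt (S : Set ℕ) (n : ℕ) : (S ∩ Set.Iio n).ncard = cnt S 0 n := by
  unfold cnt
  congr 2
  ext m; simp

lemma ud_eq (S : Set ℕ) :
    upperDensity S = limsup (fun n : ℕ => (cnt S 0 (0 + n) : ℝ) / n) atTop := by
  unfold upperDensity; simp only [Iio_cnt, zero_add]

lemma ld_eq (S : Set ℕ) :
    lowerDensity S = liminf (fun n : ℕ => (cnt S 0 (0 + n) : ℝ) / n) atTop := by
  unfold lowerDensity; simp only [Iio_cnt, zero_add]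

lemma div_le_of {c ε : ℝ} {n : ℕ} (hε : 0 ≤ ε) (h : c ≤ ε * n) : c / n ≤ ε :=
  div_le_of_le_mul₀ (by positivity) hε h

lemma UNull.ud {S : Set ℕ} (h : UNull S) : upperDensity S = 0 := by
  rw [ud_eq]
  apply ls_zero (fun n => frac_nonneg S 0 n)
  intro ε hε
  filter_upwards [h ε hε] with n hn
  rw [zero_add]
  exact div_le_of hε.le hn

lemma ud_pos {S : Set ℕ} {c : ℝ} (hc : 0 < c)
    (h : ∃ᶠ n : ℕ in atTop, c * n ≤ cnt S 0 n) : 0 < upperDensity S := by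
  rw [ud_eq]
  refine lt_of_lt_of_le hc (ls_ge (fun n => frac_le_one S 0 n) ?_)
  refine (h.and_eventually (eventually_gt_atTop 0)).mono ?_
  rintro n ⟨h1, h2⟩
  rw [zero_add, le_div_iff₀ (by exact_mod_cast h2)]
  exact h1

lemma ld_pos {S : Set ℕ} {c : ℝ} (hc : 0 < c)
    (h : ∀ᶠ n : ℕ in atTop, c * n ≤ cnt S 0 n) : 0 < lowerDensity S := by
  rw [ld_eq]
  refine lt_of_lt_of_le hc (li_ge (fun n => frac_le_one S 0 n) ?_)
  filter_upwards [h, eventually_gt_atTop 0] with n h1 h2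
  rw [zero_add, le_div_iff₀ (by exact_mod_cast h2)]
  exact h1

lemma ld_zero {S : Set ℕ} (h : ∀ ε > (0 : ℝ), ∃ᶠ n : ℕ in atTop, (cnt S 0 n : ℝ) ≤ ε * n) :
    lowerDensity S = 0 := by
  rw [ld_eq]
  apply li_zero (fun n => frac_nonneg S 0 n) (fun n => frac_le_one S 0 n)
  intro ε hε
  refine (h ε hε).mono ?_
  intro n hn
  rw [zero_add]
  exact div_le_of hε.le hn

lemma bsup_bdd (S : Set ℕ) (N : ℕ) :
    BddAbove (Set.range fun a : ℕ => (cnt S a (a + N) : ℝ) / N) :=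
  ⟨1, by rintro _ ⟨a, rfl⟩; exact frac_le_one S a N⟩

lemma binf_bdd (S : Set ℕ) (N : ℕ) :
    BddBelow (Set.range fun a : ℕ => (cnt S a (a + N) : ℝ) / N) :=
  ⟨0, by rintro _ ⟨a, rfl⟩; exact frac_nonneg S a N⟩

lemma BNull.bud {S : Set ℕ} (h : BNull S) : banachUpperDensity S = 0 := by
  change limsup (fun N : ℕ => ⨆ a : ℕ, (cnt S a (a + N) : ℝ) / N) atTop = 0
  apply ls_zero
  · exact fun N => Real.iSup_nonneg (fun a => frac_nonneg S a N)
  · intro ε hε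
    obtain ⟨C, hC⟩ := h (ε / 2) (by linarith)
    filter_upwards [ev_mul (half_pos hε) C] with N hN
    apply ciSup_le
    intro a
    apply div_le_of hε.le
    linarith [hC a N]

lemma bud_pos {S : Set ℕ} {c : ℝ} (hc : 0 < c)
    (h : ∀ᶠ N : ℕ in atTop, ∃ a, c * N ≤ cnt S a (a + N)) : 0 < banachUpperDensity S := by
  change 0 < limsup (fun N : ℕ => ⨆ a : ℕ, (cnt S a (a + N) : ℝ) / N) atTop
  refine lt_of_lt_of_le hc (ls_ge (fun N => ciSup_le (fun a => frac_le_one S a N)) ?_)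
  apply Eventually.frequently
  filter_upwards [h, eventually_gt_atTop 0] with N h1 h2
  obtain ⟨a, ha⟩ := h1
  refine le_trans ?_ (le_ciSup (bsup_bdd S N) a)
  rw [le_div_iff₀ (by exact_mod_cast h2)]
  exact ha

lemma bld_zero {S : Set ℕ} (h : ∀ N, ∃ a, cnt S a (a + N) = 0) : banachLowerDensity S = 0 := by
  change liminf (fun N : ℕ => ⨅ a : ℕ, (cnt S a (a + N) : ℝ) / N) atTop = 0
  have : (fun N : ℕ => ⨅ a : ℕ, (cnt S a (a + N) : ℝ) / N) = fun _ => 0 := by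
    funext N
    apply le_antisymm
    · obtain ⟨a, ha⟩ := h N
      refine (ciInf_le (binf_bdd S N) a).trans ?_
      simp [ha]
    · exact Real.iInf_nonneg (fun a => frac_nonneg S a N)
  rw [this]
  simp

/-! ### The metric -/

def agree {k : ℕ} (L : ℕ) (x y : ℕ → Fin k) : Prop := ∀ i < L, x i = y i

lemma sd_summable {k : ℕ} (x y : ℕ → Fin k) :
    Summable (fun n : ℕ => if x n = y n then (0 : ℝ) else (1 / 2) ^ (n + 1)) := by
  refine Summable.of_nonneg_of_le (f := fun n => (1 / 2 : ℝ) ^ n) (fun n => ?_) (fun n => ?_)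
    (summable_geometric_of_lt_one (by norm_num) (by norm_num))
  · split_ifs <;> positivity
  · split_ifs
    · positivity
    · exact pow_le_pow_of_le_one (by norm_num) (by norm_num) (by omega)

lemma agree_of_dist {k : ℕ} {x y : ℕ → Fin k} {L : ℕ} (h : shiftDist x y < (1 / 2) ^ L) :
    agree L x y := by
  intro i hi
  by_contra hne
  have h1 := (sd_summable x y).le_tsum i (fun j _ => by split_ifs <;> positivity)
  rw [if_neg hne] at h1
  have h2 : (1 / 2 : ℝ) ^ L ≤ (1 / 2) ^ (i + 1) :=
    pow_le_pow_of_le_one (by norm_num) (by norm_num) (by omega)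
  unfold shiftDist at h
  linarith

lemma dist_of_agree {k : ℕ} {x y : ℕ → Fin k} {L : ℕ} (h : agree L x y) :
    shiftDist x y ≤ (1 / 2) ^ L := by
  have hs := sd_summable x y
  unfold shiftDist
  rw [← hs.sum_add_tsum_nat_add L, Finset.sum_eq_zero, zero_add]
  · have hg : HasSum (fun n : ℕ => (1 / 2 : ℝ) ^ L * ((1 / 2) / 2 ^ n)) ((1 / 2) ^ L * 1) :=
      HasSum.mul_left _ (by simpa using hasSum_geometric_two' (1 : ℝ))
    rw [mul_one] at hg
    rw [← hg.tsum_eq]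
    apply Summable.tsum_le_tsum _ ((summable_nat_add_iff L).2 hs) hg.summable
    intro n
    split_ifs
    · positivity
    · apply le_of_eq
      rw [pow_add, pow_add]
      field_simp
      ring_nf
      simp
  · intro i hi
    rw [if_pos (h i (Finset.mem_range.1 hi))]

lemma exists_L {ε : ℝ} (hε : 0 < ε) : ∃ L : ℕ, ∀ {k : ℕ} (x y : ℕ → Fin k), agree L x y →
    shiftDist x y < ε := by
  obtain ⟨L, hL⟩ := exists_pow_lt_of_lt_one hε (by norm_num : (1 / 2 : ℝ) < 1)
  exact ⟨L, fun x y h => lt_of_le_of_lt (dist_of_agree h) hL⟩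

lemma shift_iter {k : ℕ} (x : ℕ → Fin k) (n i : ℕ) : (shift^[n] x) i = x (n + i) := by
  induction n generalizing x with
  | zero => simp
  | succ n ih =>
    rw [Function.iterate_succ_apply, ih]
    unfold shift
    congr 1
    omega

/-! ### Banach null: more -/

lemma BNull.union {S S' : Set ℕ} (h : BNull S) (h' : BNull S') : BNull (S ∪ S') := by
  intro ε hε
  obtain ⟨C, hC⟩ := h (ε / 2) (by linarith)
  obtain ⟨C', hC'⟩ := h' (ε / 2) (by linarith)
  refine ⟨C + C', fun a N => ?_⟩
  have : (cnt (S ∪ S') a (a + N) : ℝ) ≤ cnt S a (a + N) + cnt S' a (a + N) := by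
    exact_mod_cast cnt_union S S' a (a + N)
  linarith [hC a N, hC' a N]

lemma BNull.shift {S : Set ℕ} (h : BNull S) (i : ℕ) : BNull {n | n + i ∈ S} := by
  intro ε hε
  obtain ⟨C, hC⟩ := h ε hε
  refine ⟨C, fun a N => ?_⟩
  have h1 := cnt_shift' (S := {n | n + i ∈ S}) (S' := S) (a := a) (b := a + N) (d := i)
    (fun n _ _ h => h)
  rw [show a + N + i = a + i + N by ring] at h1
  exact le_trans (by exact_mod_cast h1) (hC (a + i) N)

def Qset (L : ℕ) : Set ℕ := {n | Nat.sqrt n ≠ Nat.sqrt (n + L)}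

lemma cnt_Q1 (a N : ℕ) : cnt (Qset 1) a (a + N) + Nat.sqrt a ≤ Nat.sqrt (a + N) := by
  induction N with
  | zero => simp [cnt]
  | succ N ih =>
    have h1 := cnt_split (Qset 1) a (a + N) (a + (N + 1))
    have h2 : Nat.sqrt (a + N) ≤ Nat.sqrt (a + (N + 1)) := Nat.sqrt_le_sqrt (by omega)
    have h3 := cnt_le (Qset 1) (a + N) (a + (N + 1))
    by_cases h : Nat.sqrt (a + N) = Nat.sqrt (a + (N + 1))
    · have : cnt (Qset 1) (a + N) (a + (N + 1)) = 0 := by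
        apply cnt_empty
        intro n hn1 hn2 hn
        have : n = a + N := by omega
        subst this
        exact hn h
      omega
    · omega

lemma bNull_Q1 : BNull (Qset 1) := by
  intro ε hε
  refine ⟨1 / ε + 1, fun a N => ?_⟩
  have h1 := cnt_Q1 a N
  have h2 : Nat.sqrt (a + N) ≤ Nat.sqrt a + Nat.sqrt N + 1 := by
    have ha := Nat.lt_succ_sqrt a
    have hN := Nat.lt_succ_sqrt N
    have : Nat.sqrt (a + N) < Nat.sqrt a + Nat.sqrt N + 2 := by
      rw [Nat.sqrt_lt']
      simp only [Nat.succ_eq_add_one] at ha hN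
      nlinarith
    omega
  have h3 : (cnt (Qset 1) a (a + N) : ℝ) ≤ Nat.sqrt N + 1 := by
    exact_mod_cast (show cnt (Qset 1) a (a + N) ≤ Nat.sqrt N + 1 by omega)
  have h4 : ((Nat.sqrt N : ℕ) : ℝ) ^ 2 ≤ N := by exact_mod_cast Nat.sqrt_le' N
  have h5 : ((Nat.sqrt N : ℕ) : ℝ) ≤ ε * N + 1 / ε := by
    set s : ℝ := ((Nat.sqrt N : ℕ) : ℝ)
    have h6 : s ≤ ε * s ^ 2 + 1 / ε := by
      rw [← sub_nonneg]
      have : ε * s ^ 2 + 1 / ε - s = ((ε * s - 1 / 2) ^ 2 + 3 / 4) / ε := by field_simp; ring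
      rw [this]; positivity
    nlinarith
  linarith

lemma bNull_Q (L : ℕ) : BNull (Qset L) := by
  induction L with
  | zero =>
    intro ε hε
    refine ⟨0, fun a N => ?_⟩
    rw [cnt_empty (by intro n _ _ h; exact h rfl)]
    push_cast
    positivity
  | succ L ih =>
    refine (ih.union (bNull_Q1.shift L)).mono ?_
    intro n hn
    by_cases h : Nat.sqrt n = Nat.sqrt (n + L)
    · right
      change Nat.sqrt (n + L) ≠ Nat.sqrt (n + L + 1)
      rw [← h]; exact hn
    · exact Or.inl h

/-! ### The construction -/

structure Par (k : ℕ) where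
  a : Fin k
  b : Fin k
  hab : a ≠ b
  c : ℕ
  hc : 4 ≤ c
  init : ℕ → Fin k
  e : Bool
  F : ℕ → Bool

namespace Par

variable {k : ℕ} (p : Par k)

def M (j : ℕ) : ℕ := (j + p.c).factorial

def N (j : ℕ) : ℕ := (2 * p.M j) ^ 2

def C (s : Bool) : Fin k := if s then p.b else p.a

def alt (n : ℕ) : Fin k := if n % 2 = 0 then p.a else p.b

open Classical in
noncomputable def col (m n : ℕ) : Fin k :=
  if p.e = true ∧ ∃ j, m = 3 * p.M (j + 1) then p.alt n else p.C (p.F m)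

def Zone (n : ℕ) : Prop := ∃ j, p.N (j + 1) ≤ n ∧ n < p.N (j + 1) + p.N j

lemma M_pos (j : ℕ) : 0 < p.M j := Nat.factorial_pos _

lemma N_pos (j : ℕ) : 0 < p.N j := by have := p.M_pos j; unfold N; positivity

lemma M_succ (j : ℕ) : p.M (j + 1) = (j + 1 + p.c) * p.M j := by
  unfold M
  rw [show j + 1 + p.c = (j + p.c) + 1 by ring, Nat.factorial_succ]

lemma N_succ (j : ℕ) : p.N (j + 1) = (j + 1 + p.c) ^ 2 * p.N j := by
  unfold N
  rw [M_succ]; ring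

lemma N_grow (j : ℕ) : 25 * p.N j ≤ p.N (j + 1) := by
  rw [N_succ]
  apply Nat.mul_le_mul_right
  have := p.hc
  have := Nat.pow_le_pow_left (show 5 ≤ j + 1 + p.c by omega) 2
  omega

lemma M_grow (j : ℕ) : 5 * p.M j ≤ p.M (j + 1) := by
  rw [M_succ]
  apply Nat.mul_le_mul_right
  have := p.hc
  omega

lemma N_strictMono : StrictMono p.N :=
  strictMono_nat_of_lt_succ (fun j => by have := p.N_grow j; have := p.N_pos j; omega)

lemma N_mono {i j : ℕ} (h : i ≤ j) : p.N i ≤ p.N j := p.N_strictMono.monotone h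

lemma exists_stage {n : ℕ} (h : p.N 0 ≤ n) : ∃ j, p.N j ≤ n ∧ n < p.N (j + 1) := by
  have hex : ∃ j, n < p.N (j + 1) := ⟨n, lt_of_lt_of_le (Nat.lt_succ_self n) (p.N_strictMono.id_le _)⟩
  classical
  refine ⟨Nat.find hex, ?_, Nat.find_spec hex⟩
  rcases hj : Nat.find hex with _ | j
  · exact h
  · have := Nat.find_min hex (m := j) (by omega)
    omega

lemma zone_unique {n i j : ℕ} (h1 : p.N (i + 1) ≤ n) (h2 : n < p.N (i + 1) + p.N i)
    (h3 : p.N j ≤ n) (h4 : n < p.N (j + 1)) : j = i + 1 := by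
  have := p.N_grow i
  have := p.N_grow (i + 1)
  rcases lt_trichotomy j (i + 1) with h | h | h
  · have := p.N_mono (show j + 1 ≤ i + 1 by omega)
    omega
  · exact h
  · have := p.N_mono (show i + 2 ≤ j by omega)
    have e : i + 1 + 1 = i + 2 := rfl
    rw [e] at *
    omega

open Classical in
noncomputable def x (n : ℕ) : Fin k :=
  if n < p.N 0 then p.init n
  else if h : p.Zone n then x (n - p.N (h.choose + 1)) else p.col (Nat.sqrt n) n
termination_by n
decreasing_by
  have := h.choose_spec
  have := p.N_pos (h.choose + 1)
  omega

lemma x_init {n : ℕ} (h : n < p.N 0) : p.x n = p.init n := by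
  rw [x, if_pos h]

lemma x_copy {n j : ℕ} (h1 : p.N (j + 1) ≤ n) (h2 : n < p.N (j + 1) + p.N j) :
    p.x n = p.x (n - p.N (j + 1)) := by
  have h0 : ¬ n < p.N 0 := by
    have := p.N_mono (show 0 ≤ j + 1 by omega)
    omega
  have hz : p.Zone n := ⟨j, h1, h2⟩
  rw [x, if_neg h0, dif_pos hz]
  have hs := hz.choose_spec
  have := p.zone_unique hs.1 hs.2 h1 (by have := p.N_grow (j + 1); have := p.N_grow j; omega)
  rw [← this]

lemma x_col {n : ℕ} (h0 : p.N 0 ≤ n) (h : ¬ p.Zone n) : p.x n = p.col (Nat.sqrt n) n := by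
  rw [x, if_neg (by omega), dif_neg h]

lemma not_zone {n j : ℕ} (h1 : p.N (j + 1) + p.N j ≤ n) (h2 : n < p.N (j + 2)) : ¬ p.Zone n := by
  rintro ⟨i, h3, h4⟩
  have := p.zone_unique h3 h4 (j := j + 1) (by omega) h2
  have : i = j := by omega
  subst this
  omega

lemma x_main {n j : ℕ} (h1 : p.N (j + 1) + p.N j ≤ n) (h2 : n < p.N (j + 2)) :
    p.x n = p.col (Nat.sqrt n) n :=
  p.x_col (by have := p.N_mono (show 0 ≤ j + 1 by omega); omega) (p.not_zone h1 h2)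

def al (s : ℕ) : ℕ → Fin k := fun i => p.alt (i + s)

def cst (s : Bool) : ℕ → Fin k := fun _ => p.C s

def Y : Set (ℕ → Fin k) :=
  {y | (∃ s, y = p.cst s) ∨ (p.e = true ∧ ∃ s < 2, y = p.al s)}

def T (L : ℕ) : Set ℕ := {n | ∀ y ∈ p.Y, ¬ ∀ i < L, p.x (n + i) = y i}

lemma sqrt_between {n i L : ℕ} (h : Nat.sqrt n = Nat.sqrt (n + L)) (hi : i < L) :
    Nat.sqrt (n + i) = Nat.sqrt n :=
  le_antisymm (h ▸ Nat.sqrt_le_sqrt (by omega)) (Nat.sqrt_le_sqrt (by omega))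

lemma T_main {n j L : ℕ} (h1 : p.N (j + 1) + p.N j ≤ n) (h2 : n + L ≤ p.N (j + 2))
    (hT : n ∈ p.T L) : n ∈ Qset L := by
  intro hs
  have hx : ∀ i < L, p.x (n + i) = p.col (Nat.sqrt n) (n + i) := by
    intro i hi
    rw [p.x_main (j := j) (by omega) (by omega), sqrt_between hs hi]
  by_cases hc : p.e = true ∧ ∃ j, Nat.sqrt n = 3 * p.M (j + 1)
  · refine hT (p.al (n % 2)) (Or.inr ⟨hc.1, n % 2, Nat.mod_lt _ (by norm_num), rfl⟩) ?_
    intro i hi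
    rw [hx i hi, col, if_pos hc, al, alt, alt]
    congr 2
    omega
  · refine hT (p.cst (p.F (Nat.sqrt n))) (Or.inl ⟨_, rfl⟩) ?_
    intro i hi
    rw [hx i hi, col, if_neg hc, cst]

lemma cnt_main {q P L : ℕ} (hq : ∀ a R, R ≤ 2 * P → cnt (Qset L) a (a + R) ≤ q)
    {u v j : ℕ} (h1 : p.N (j + 1) + p.N j ≤ u) (h2 : v ≤ p.N (j + 2)) (h3 : v ≤ u + 2 * P) :
    cnt (p.T L) u v ≤ q + L := by
  have s := cnt_split (p.T L) u (v - L) v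
  have e1 := cnt_le (p.T L) (v - L) v
  have e2 : cnt (p.T L) u (v - L) ≤ cnt (Qset L) u (u + (v - u)) :=
    cnt_mono le_rfl (by omega) (fun n h4 h5 h6 => p.T_main (j := j) (by omega) (by omega) h6)
  have e3 := hq u (v - u) (by omega)
  omega

lemma T_copy {n j L : ℕ} (h1 : p.N (j + 1) ≤ n) (h2 : n + L ≤ p.N (j + 1) + p.N j)
    (hT : n ∈ p.T L) : n - p.N (j + 1) ∈ p.T L := by
  intro y hy h
  refine hT y hy ?_
  intro i hi
  rw [p.x_copy (j := j) (by omega) (by omega), ← h i hi]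
  congr 1
  omega

lemma cnt_copy' {L u v j : ℕ} (h1 : p.N (j + 1) ≤ u) (h2 : v + L ≤ p.N (j + 1) + p.N j) :
    cnt (p.T L) u v ≤ cnt (p.T L) (u - p.N (j + 1)) (v - p.N (j + 1)) :=
  cnt_shift h1 (fun n h3 h4 h5 => p.T_copy (j := j) (by omega) (by omega) h5)

lemma cnt_copy {L u v j : ℕ} (h1 : p.N (j + 1) ≤ u) (h2 : v ≤ p.N (j + 1) + p.N j) :
    cnt (p.T L) u v ≤ cnt (p.T L) (u - p.N (j + 1)) (v - p.N (j + 1)) + L := by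
  have s := cnt_split (p.T L) u (v - L) v
  have e1 := cnt_le (p.T L) (v - L) v
  by_cases hv : L ≤ v
  · have e2 := p.cnt_copy' (L := L) (u := u) (v := v - L) (j := j) h1 (by omega)
    have e3 := cnt_mono (S := p.T L) (S' := p.T L) (a := u - p.N (j + 1)) (a' := u - p.N (j + 1))
      (b := v - L - p.N (j + 1)) (b' := v - p.N (j + 1)) le_rfl (by omega) (fun n _ _ h => h)
    omega
  · have := cnt_le (p.T L) u v
    omega

lemma cnt_window {q L s : ℕ} (hq : ∀ a R, R ≤ 2 * p.N (s + 2) → cnt (Qset L) a (a + R) ≤ q)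
    (hL : L ≤ p.N (s + 1)) (a : ℕ) :
    cnt (p.T L) a (a + p.N (s + 2)) ≤ 3 * p.N (s + 1) + 5 * q + 10 * L := by
  have g0 := p.N_grow s
  have g1 := p.N_grow (s + 1)
  have g2 := p.N_grow (s + 2)
  simp only [show s + 1 + 1 = s + 2 from rfl, show s + 2 + 1 = s + 3 from rfl] at g0 g1 g2
  have A : cnt (p.T L) 0 (2 * p.N (s + 2)) ≤ 3 * p.N (s + 1) + 2 * q + 2 * L := by
    have s1 := cnt_split (p.T L) 0 (p.N (s + 1) + p.N s) (2 * p.N (s + 2))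
    have s2 := cnt_split (p.T L) (p.N (s + 1) + p.N s) (p.N (s + 2)) (2 * p.N (s + 2))
    have s3 := cnt_split (p.T L) (p.N (s + 2)) (p.N (s + 2) + p.N (s + 1)) (2 * p.N (s + 2))
    have e1 := cnt_le (p.T L) 0 (p.N (s + 1) + p.N s)
    have e2 := p.cnt_main hq (u := p.N (s + 1) + p.N s) (v := p.N (s + 2)) (j := s) le_rfl le_rfl
      (by omega)
    have e3 := cnt_le (p.T L) (p.N (s + 2)) (p.N (s + 2) + p.N (s + 1))
    have e4 := p.cnt_main hq (u := p.N (s + 2) + p.N (s + 1)) (v := 2 * p.N (s + 2)) (j := s + 1)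
      le_rfl (by rw [show s + 1 + 2 = s + 3 from rfl]; omega) (by omega)
    omega
  have A' : ∀ u v, v ≤ 2 * p.N (s + 2) →
      cnt (p.T L) u v ≤ 3 * p.N (s + 1) + 2 * q + 2 * L := fun u v hv =>
    (cnt_mono (Nat.zero_le _) hv (fun n _ _ h => h)).trans A
  induction a using Nat.strong_induction_on with
  | _ a ih =>
  by_cases ha : a < p.N (s + 2)
  · have := A' a (a + p.N (s + 2)) (by omega)
    omega
  push Not at ha
  obtain ⟨j', hj1, hj2⟩ := p.exists_stage (n := a) ((p.N_mono (Nat.zero_le _)).trans ha)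
  have hj' : s + 2 < j' + 1 := p.N_strictMono.lt_iff_lt.1 (lt_of_le_of_lt ha hj2)
  obtain ⟨j, rfl⟩ : ∃ j, j' = j + 1 := ⟨j' - 1, by omega⟩
  rw [show j + 1 + 1 = j + 2 from rfl] at hj2
  have k0 := p.N_grow j
  have k1 := p.N_grow (j + 1)
  rw [show j + 1 + 1 = j + 2 from rfl] at k1
  have k2 := p.N_mono (show s + 2 ≤ j + 1 by omega)
  have kp := p.N_pos (j + 1)
  by_cases c1 : a + p.N (s + 2) + L ≤ p.N (j + 1) + p.N j
  · have e := p.cnt_copy' (L := L) (u := a) (j := j) hj1 c1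
    rw [show a + p.N (s + 2) - p.N (j + 1) = a - p.N (j + 1) + p.N (s + 2) by omega] at e
    exact e.trans (ih _ (by omega))
  by_cases c2 : p.N (j + 2) < a + p.N (s + 2)
  · have s1 := cnt_split (p.T L) a (p.N (j + 2)) (a + p.N (s + 2))
    have e1 := p.cnt_main hq (u := a) (v := p.N (j + 2)) (j := j) (by omega) le_rfl (by omega)
    have e2 := p.cnt_copy (L := L) (u := p.N (j + 2)) (v := a + p.N (s + 2)) (j := j + 1) le_rfl
      (by rw [show j + 1 + 1 = j + 2 from rfl]; omega)
    have e3 := A' (p.N (j + 1 + 1) - p.N (j + 1 + 1)) (a + p.N (s + 2) - p.N (j + 1 + 1))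
      (by rw [show j + 1 + 1 = j + 2 from rfl]; omega)
    rw [show j + 1 + 1 = j + 2 from rfl] at e2 e3
    omega
  push Not at c1 c2
  by_cases c3 : p.N (j + 1) + p.N j ≤ a
  · have := p.cnt_main hq (u := a) (v := a + p.N (s + 2)) (j := j) c3 c2 (by omega)
    omega
  push Not at c3
  have s1 := cnt_split (p.T L) a (p.N (j + 1) + p.N j) (a + p.N (s + 2))
  have e1 := p.cnt_main hq (u := p.N (j + 1) + p.N j) (v := a + p.N (s + 2)) (j := j) le_rfl c2
    (by omega)
  have e2 := p.cnt_copy (L := L) (u := a) (v := p.N (j + 1) + p.N j) (j := j) hj1 le_rfl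
  rw [show p.N (j + 1) + p.N j - p.N (j + 1) = p.N j by omega] at e2
  by_cases c4 : j ≤ s + 2
  · have := p.N_mono c4
    have := A' (a - p.N (j + 1)) (p.N j) (by omega)
    omega
  · obtain ⟨i, rfl⟩ : ∃ i, j = i + 2 := ⟨j - 2, by omega⟩
    have i0 := p.N_grow i
    have i1 := p.N_grow (i + 1)
    have i2 := p.N_mono (show s + 2 ≤ i + 1 by omega)
    rw [show i + 1 + 1 = i + 2 from rfl] at i1
    have := p.cnt_main hq (u := a - p.N (i + 2 + 1)) (v := p.N (i + 2)) (j := i) (by omega) le_rfl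
      (by omega)
    omega

lemma id_le_N (j : ℕ) : j ≤ p.N j := p.N_strictMono.id_le j

lemma bNull_T (L : ℕ) : BNull (p.T L) := by
  apply bNull_of_window
  intro ε hε
  set δ := ε / 13 with hδ
  have hδ0 : 0 < δ := by positivity
  obtain ⟨C, hC⟩ := bNull_Q L δ hδ0
  obtain ⟨s, hs1, hs2, hs3⟩ := ((ev_mul hδ0 3).and ((ev_mul hδ0 (5 * C + 10 * L)).and
    (eventually_ge_atTop L))).exists
  refine ⟨p.N (s + 2), p.N_pos _, fun a => ?_⟩
  set P := p.N (s + 2) with hP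
  have hPs : (s : ℝ) ≤ P := by exact_mod_cast (show s ≤ P by have := p.id_le_N (s + 2); omega)
  have hPN : (s : ℝ) * p.N (s + 1) ≤ P := by
    have : s * p.N (s + 1) ≤ P := by
      have e : P = (s + 1 + 1 + p.c) ^ 2 * p.N (s + 1) := p.N_succ (s + 1)
      rw [e]
      apply Nat.mul_le_mul_right
      have := Nat.le_self_pow (two_ne_zero) (s + 1 + 1 + p.c)
      omega
    exact_mod_cast this
  have hC0 : 0 ≤ C := by
    have := hC 0 0
    push_cast at this
    have : (0 : ℝ) ≤ (cnt (Qset L) 0 (0 + 0) : ℝ) := by positivity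
    linarith
  have hq : ∀ a R, R ≤ 2 * P → cnt (Qset L) a (a + R) ≤ ⌊δ * (2 * P) + C⌋₊ := by
    intro a R hR
    apply Nat.le_floor
    refine (hC a R).trans ?_
    have : (R : ℝ) ≤ 2 * P := by exact_mod_cast hR
    nlinarith
  have key := p.cnt_window hq (by have := p.id_le_N (s + 1); omega) a
  have hf : (⌊δ * (2 * P) + C⌋₊ : ℝ) ≤ δ * (2 * P) + C := Nat.floor_le (by positivity)
  have key' : (cnt (p.T L) a (a + P) : ℝ) ≤
      3 * p.N (s + 1) + 5 * (⌊δ * (2 * P) + C⌋₊ : ℕ) + 10 * L := by exact_mod_cast key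
  have h3 : (3 : ℝ) * p.N (s + 1) ≤ δ * P := by
    have : (0 : ℝ) ≤ p.N (s + 1) := by positivity
    nlinarith
  have h4 : δ * s ≤ δ * P := by nlinarith
  have : ε * P = 13 * (δ * P) := by rw [hδ]; ring
  rw [this]
  have : 0 ≤ δ * P := by positivity
  nlinarith

/-! ### The exceptional set -/

def E : Set ℕ := {n | n < p.N 0 ∨ p.Zone n ∨ ∃ j, Nat.sqrt n = 3 * p.M (j + 1)}

lemma x_notE {n : ℕ} (h : n ∉ p.E) : p.x n = p.C (p.F (Nat.sqrt n)) := by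
  simp only [E, Set.mem_ofPred_eq, not_or, not_lt] at h
  rw [p.x_col h.1 h.2.1, col, if_neg (fun h' => h.2.2 h'.2)]

lemma M_mono {i j : ℕ} (h : i ≤ j) : p.M i ≤ p.M j := Nat.factorial_le (by omega)

lemma stageE {j v : ℕ} (hv : v ≤ p.N (j + 2)) :
    cnt p.E (p.N (j + 1)) v ≤ p.N j + 6 * p.M (j + 1) + 1 := by
  have s1 := cnt_split p.E (p.N (j + 1)) (p.N (j + 1) + p.N j) v
  have s2 := cnt_split p.E (p.N (j + 1) + p.N j) ((3 * p.M (j + 1)) ^ 2) v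
  have s3 := cnt_split p.E ((3 * p.M (j + 1)) ^ 2) ((3 * p.M (j + 1) + 1) ^ 2) v
  have e1 := cnt_le p.E (p.N (j + 1)) (p.N (j + 1) + p.N j)
  have e2 := cnt_le p.E ((3 * p.M (j + 1)) ^ 2) ((3 * p.M (j + 1) + 1) ^ 2)
  have r : (3 * p.M (j + 1) + 1) ^ 2 = (3 * p.M (j + 1)) ^ 2 + (6 * p.M (j + 1) + 1) := by ring
  have hN2 : p.N (j + 2) = (2 * p.M (j + 2)) ^ 2 := rfl
  have m1 := p.M_grow (j + 1)
  rw [show j + 1 + 1 = j + 2 from rfl] at m1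
  have gen : ∀ n, p.N (j + 1) + p.N j ≤ n → n < p.N (j + 2) →
      Nat.sqrt n ≠ 3 * p.M (j + 1) → n ∉ p.E := by
    rintro n h1 h2 h3 (h4 | h4 | ⟨i, h4⟩)
    · have := p.N_mono (show 0 ≤ j + 1 by omega); omega
    · exact p.not_zone h1 h2 h4
    · have l1 : Nat.sqrt n < 2 * p.M (j + 2) := by rw [Nat.sqrt_lt']; rw [← hN2]; exact h2
      have l2 : 2 * p.M (j + 1) ≤ Nat.sqrt n := by
        rw [Nat.le_sqrt']; exact le_trans (Nat.le_add_right _ _) h1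
      rcases lt_trichotomy i j with h | h | h
      · have := p.M_mono (show i + 1 ≤ j by omega)
        have := p.M_grow j
        have := p.M_pos j
        omega
      · subst h; exact h3 h4
      · have := p.M_mono (show j + 2 ≤ i + 1 by omega)
        omega
  have z1 : ∀ w, w ≤ v → w ≤ (3 * p.M (j + 1)) ^ 2 → cnt p.E (p.N (j + 1) + p.N j) w = 0 := by
    intro w hw hw2
    apply cnt_empty
    intro n h1 h2
    apply gen n h1 (by omega)
    have : Nat.sqrt n < 3 * p.M (j + 1) := by rw [Nat.sqrt_lt']; omega
    omega
  have z2 : cnt p.E ((3 * p.M (j + 1) + 1) ^ 2) v = 0 := by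
    apply cnt_empty
    intro n h1 h2
    apply gen n _ (by omega)
    · have : 3 * p.M (j + 1) + 1 ≤ Nat.sqrt n := by rw [Nat.le_sqrt']; exact h1
      omega
    · refine le_trans ?_ h1
      rw [r]
      have := p.N_grow j
      have : p.N (j + 1) = (2 * p.M (j + 1)) ^ 2 := rfl
      nlinarith
  by_cases hw : v ≤ (3 * p.M (j + 1)) ^ 2
  · have := z1 v le_rfl hw
    omega
  · have := z1 _ (le_of_not_ge hw) le_rfl
    omega

lemma uNull_E : UNull p.E := by
  intro ε hε
  obtain ⟨K, hK⟩ := (ev_mul hε 8).exists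
  filter_upwards [eventually_ge_atTop (p.N (K + 2))] with n hn
  obtain ⟨j', hj1, hj2⟩ := p.exists_stage (n := n) ((p.N_mono (Nat.zero_le _)).trans hn)
  have hj' : K + 2 < j' + 1 := p.N_strictMono.lt_iff_lt.1 (lt_of_le_of_lt hn hj2)
  obtain ⟨i, rfl⟩ : ∃ i, j' = i + 2 := ⟨j' - 2, by omega⟩
  have s1 := cnt_split p.E 0 (p.N (i + 1)) n
  have s2 := cnt_split p.E (p.N (i + 1)) (p.N (i + 2)) n
  have e1 := cnt_le p.E 0 (p.N (i + 1))
  have e2 := p.stageE (j := i) (v := p.N (i + 2)) le_rfl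
  have e3 := p.stageE (j := i + 1) (v := n) (by exact hj2.le)
  rw [show i + 1 + 1 = i + 2 from rfl] at e3
  have g := p.N_grow i
  have m := p.M_grow (i + 1)
  rw [show i + 1 + 1 = i + 2 from rfl] at m
  have tot : cnt p.E 0 n ≤ 3 * p.N (i + 1) + 12 * p.M (i + 2) + 2 := by omega
  have f1 : p.N (i + 2) = (i + 2 + p.c) ^ 2 * p.N (i + 1) := p.N_succ (i + 1)
  have f2 : p.N (i + 2) = (2 * p.M (i + 2)) ^ 2 := rfl
  have f3 : K ≤ p.M (i + 2) := by
    have := Nat.self_le_factorial (i + 2 + p.c)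
    unfold M; omega
  have f4 : K * p.N (i + 1) ≤ n := by
    refine le_trans ?_ hj1
    rw [f1]
    apply Nat.mul_le_mul_right
    have := Nat.le_self_pow (two_ne_zero) (i + 2 + p.c)
    omega
  have f5 : 4 * (K * p.M (i + 2)) ≤ n := by
    refine le_trans ?_ hj1
    rw [f2]
    nlinarith
  have f6 : K ≤ n := by
    have := p.M_pos (i + 2)
    nlinarith
  have tot2 : K * cnt p.E 0 n ≤ 8 * n := by nlinarith
  have hK0 : 0 < (K : ℝ) := by
    by_contra hh
    nlinarith
  have tot3 : (K * cnt p.E 0 n : ℝ) ≤ 8 * n := by exact_mod_cast tot2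
  have : (cnt p.E 0 n : ℝ) * K ≤ ε * n * K := by nlinarith [show (0:ℝ) ≤ n by positivity]
  exact le_of_mul_le_mul_right this hK0

def EL (L : ℕ) : Set ℕ := {n | ∃ i < L, p.x (n + i) ≠ p.C (p.F (Nat.sqrt n))}

lemma uNull_EL (L : ℕ) : UNull (p.EL L) := by
  refine ((p.uNull_E.window L).union (bNull_Q L).uNull).mono ?_
  rintro n ⟨i, hi, h⟩
  by_contra hn
  simp only [Set.mem_union, not_or, Set.mem_ofPred_eq, not_exists, not_and] at hn
  have hs : Nat.sqrt n = Nat.sqrt (n + L) := not_not.1 hn.2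
  apply h
  rw [p.x_notE (hn.1 i hi), sqrt_between hs hi]

end Par

/-! ### ω-limit sets -/

lemma visits_imp {k : ℕ} {x y : ℕ → Fin k} {L n : ℕ} (h : n ∈ visits x (sball y ((1 / 2) ^ L))) :
    ∀ i < L, x (n + i) = y i := by
  intro i hi
  rw [← shift_iter x n i]
  exact (agree_of_dist h.2 i hi).symm

lemma exists_vis {ε : ℝ} (hε : 0 < ε) : ∃ L : ℕ, ∀ {k : ℕ} (x y : ℕ → Fin k) (n : ℕ),
    (∀ i < L, x (n + i) = y i) → shift^[n] x ∈ sball y ε := by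
  obtain ⟨L, hL⟩ := exists_L hε
  refine ⟨L, fun x y n h => hL _ _ ?_⟩
  intro i hi
  rw [shift_iter, h i hi]

lemma half_pow_pos (L : ℕ) : (0 : ℝ) < (1 / 2) ^ L := by positivity

lemma fin_sep {k : ℕ} {Y : Set (ℕ → Fin k)} (hY : Y.Finite) {z : ℕ → Fin k} (hz : z ∉ Y) :
    ∃ L : ℕ, ∀ y ∈ Y, ∃ i < L, z i ≠ y i := by
  have h : ∀ y : ℕ → Fin k, ∃ i, y ∈ Y → z i ≠ y i := by
    intro y
    by_cases hy : y ∈ Y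
    · have : z ≠ y := fun h => hz (h ▸ hy)
      obtain ⟨i, hi⟩ := Function.ne_iff.1 this
      exact ⟨i, fun _ => hi⟩
    · exact ⟨0, fun h => absurd h hy⟩
  choose f hf using h
  refine ⟨hY.toFinset.sup f + 1, fun y hy => ⟨f y, ?_, hf y hy⟩⟩
  exact Nat.lt_succ_of_le (Finset.le_sup (hY.mem_toFinset.2 hy))

lemma cnt_even {V : Set ℕ} {n N : ℕ} (h : ∀ i, 2 * i < N → n + 2 * i ∈ V) :
    N ≤ 2 * cnt V n (n + N) := by
  have h1 : cnt Set.univ 0 ((N + 1) / 2) = (N + 1) / 2 - 0 := cnt_full (S := Set.univ) (fun _ _ _ => Set.mem_univ _)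
  have h2 : cnt Set.univ 0 ((N + 1) / 2) ≤ cnt V n (n + N) := by
    apply Set.ncard_le_ncard_of_injOn (fun i => n + 2 * i) _ _ (cnt_fin _ _ _)
    · rintro i ⟨_, _, h3⟩
      exact ⟨h i (by omega), by omega, by omega⟩
    · intro i _ j _ hij
      simp only at hij
      omega
  omega

namespace Par

variable {k : ℕ} (p : Par k)

def G (c : Bool) : Set ℕ := {n | p.F (Nat.sqrt n) = c}

def Hup (c : Bool) : Prop :=
  ∃ᶠ j in atTop, ∀ w, p.M j ≤ w → w < p.M (j + 1) → p.F (2 * w) = c ∨ p.F (2 * w + 1) = c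

lemma C_inj {s t : Bool} (h : p.C s = p.C t) : s = t := by
  have := p.hab
  have := p.hab.symm
  unfold C at h
  cases s <;> cases t <;> simp_all

lemma cnt_half {c : Bool} {u v : ℕ} (huv : u ≤ v)
    (h : ∀ w, u ≤ w → w < v → p.F (2 * w) = c ∨ p.F (2 * w + 1) = c) :
    (2 * v) ^ 2 ≤ 4 * cnt (p.G c) ((2 * u) ^ 2) ((2 * v) ^ 2) + (2 * u) ^ 2 := by
  induction v, huv using Nat.le_induction with
  | base => omega
  | succ v huv ih =>
    have ih := ih (fun w h1 h2 => h w h1 (by omega))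
    have e1 := cnt_add (p.G c) (a := (2 * u) ^ 2) (b := (2 * v) ^ 2) (c := (2 * (v + 1)) ^ 2)
      (Nat.pow_le_pow_left (by omega) 2) (Nat.pow_le_pow_left (by omega) 2)
    have r1 : (2 * v + 1) ^ 2 = (2 * v) ^ 2 + (4 * v + 1) := by ring
    have r2 : (2 * (v + 1)) ^ 2 = (2 * v) ^ 2 + (8 * v + 4) := by ring
    have blk : ∀ m, p.F m = c → ∀ n, m ^ 2 ≤ n → n < (m + 1) ^ 2 → n ∈ p.G c := by
      intro m hm n h1 h2
      have : Nat.sqrt n = m := by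
        apply le_antisymm
        · exact Nat.lt_succ_iff.1 (Nat.sqrt_lt'.2 h2)
        · exact Nat.le_sqrt'.2 h1
      change p.F (Nat.sqrt n) = c
      rw [this, hm]
    have e2 : 4 * v + 1 ≤ cnt (p.G c) ((2 * v) ^ 2) ((2 * (v + 1)) ^ 2) := by
      rcases h v huv (by omega) with h' | h'
      · have f1 := cnt_full (blk _ h')
        have f2 := cnt_mono (S := p.G c) (S' := p.G c) (a := (2 * v) ^ 2) (a' := (2 * v) ^ 2)
          (b := (2 * v + 1) ^ 2) (b' := (2 * (v + 1)) ^ 2) le_rfl (by omega) (fun _ _ _ h => h)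
        omega
      · have f1 := cnt_full (blk _ h')
        have f2 := cnt_mono (S := p.G c) (S' := p.G c) (a := (2 * v + 1) ^ 2) (a' := (2 * v) ^ 2)
          (b := (2 * v + 1 + 1) ^ 2) (b' := (2 * (v + 1)) ^ 2) (by omega)
          (by apply le_of_eq; ring) (fun _ _ _ h => h)
        have r3 : (2 * v + 1 + 1) ^ 2 = (2 * v) ^ 2 + (8 * v + 4) := by ring
        omega
    omega

lemma tendN : Tendsto (fun j => p.N (j + 1)) atTop atTop :=
  p.N_strictMono.tendsto_atTop.comp (tendsto_add_atTop_nat 1)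

lemma up_cnt {c : Bool} (h : p.Hup c) :
    ∃ᶠ n : ℕ in atTop, (1 / 8 : ℝ) * n ≤ cnt (p.G c) 0 n := by
  refine p.tendN.frequently (h.mono ?_)
  intro j hj
  have h1 := p.cnt_half (p.M_mono (Nat.le_succ j)) hj
  have h2 := cnt_mono (S := p.G c) (S' := p.G c) (a := (2 * p.M j) ^ 2) (a' := 0)
          (b := (2 * p.M (j + 1)) ^ 2) (b' := p.N (j + 1)) (Nat.zero_le _) le_rfl (fun _ _ _ h => h)
  have h3 := p.N_grow j
  change p.N (j + 1) ≤ _ + p.N j at h1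
  have h4 : p.N (j + 1) ≤ 8 * cnt (p.G c) 0 (p.N (j + 1)) := by
    simp only [Nat.succ_eq_add_one] at h1
    omega
  have h5 : (p.N (j + 1) : ℝ) ≤ 8 * cnt (p.G c) 0 (p.N (j + 1)) := by exact_mod_cast h4
  linarith

lemma low_cnt {c : Bool} (h : ∀ w, p.F (2 * w) = c ∨ p.F (2 * w + 1) = c) :
    ∀ᶠ n : ℕ in atTop, (1 / 8 : ℝ) * n ≤ cnt (p.G c) 0 n := by
  filter_upwards [eventually_ge_atTop 36] with n hn
  have h0 : 6 ≤ Nat.sqrt n := by rw [Nat.le_sqrt']; omega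
  obtain ⟨v, hv⟩ : ∃ v, v = Nat.sqrt n / 2 := ⟨_, rfl⟩
  have h1 := p.cnt_half (c := c) (Nat.zero_le v) (fun w _ _ => h w)
  have h2 : (2 * v) ^ 2 ≤ n := by rw [← Nat.le_sqrt']; omega
  have h3 : n < (2 * v + 2) ^ 2 := by rw [← Nat.sqrt_lt']; omega
  have h4 := cnt_mono (S := p.G c) (S' := p.G c) (a := (2 * 0) ^ 2) (a' := 0)
          (b := (2 * v) ^ 2) (b' := n) (Nat.zero_le _) h2 (fun _ _ _ h => h)
  have h5 : 3 ≤ v := by omega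
  have h6 : n ≤ 8 * cnt (p.G c) 0 n := by nlinarith
  have h7 : (n : ℝ) ≤ 8 * cnt (p.G c) 0 n := by exact_mod_cast h6
  linarith

lemma freq_small {R U : Set ℕ} (hU : UNull U)
    (h : ∃ᶠ j in atTop, ∀ n, p.N j ≤ n → n < p.N (j + 1) → n ∈ R → n ∈ U) :
    ∀ ε > (0 : ℝ), ∃ᶠ n : ℕ in atTop, (cnt R 0 n : ℝ) ≤ ε * n := by
  intro ε hε
  refine p.tendN.frequently ((h.and_eventually ((p.tendN.eventually (hU (ε / 2) (half_pos hε))).and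
    (ev_mul (half_pos hε) 1))).mono ?_)
  rintro j ⟨h1, h2, h3⟩
  have s := cnt_split R 0 (p.N j) (p.N (j + 1))
  have e1 := cnt_le R 0 (p.N j)
  have e2 := cnt_mono (S := R) (S' := U) (a := p.N j) (a' := 0) (b := p.N (j + 1))
    (b' := p.N (j + 1)) (Nat.zero_le _) le_rfl h1
  have e3 : (cnt R 0 (p.N (j + 1)) : ℝ) ≤ p.N j + cnt U 0 (p.N (j + 1)) := by
    exact_mod_cast (show cnt R 0 (p.N (j + 1)) ≤ p.N j + cnt U 0 (p.N (j + 1)) by omega)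
  have e4 : (j : ℝ) * p.N j ≤ p.N (j + 1) := by
    have : j * p.N j ≤ p.N (j + 1) := by
      rw [N_succ]
      apply Nat.mul_le_mul_right
      have := Nat.le_self_pow (two_ne_zero) (j + 1 + p.c)
      omega
    exact_mod_cast this
  have e5 : (p.N j : ℝ) ≤ ε / 2 * p.N (j + 1) := by
    have : (0 : ℝ) ≤ p.N j := by positivity
    nlinarith
  linarith

lemma vis_ge (c : Bool) {ε : ℝ} (hε : 0 < ε) : ∃ L, ∀ n,
    cnt (p.G c) 0 n ≤ cnt (visits p.x (sball (p.cst c) ε)) 0 n + cnt (p.EL L) 0 n + 1 := by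
  obtain ⟨L, hL⟩ := exists_vis hε
  refine ⟨L, fun n => ?_⟩
  have s := cnt_split (p.G c) 0 1 n
  have e1 := cnt_le (p.G c) 0 1
  have e2 := cnt_mono (S := p.G c) (S' := visits p.x (sball (p.cst c) ε) ∪ p.EL L) (a := 1)
    (a' := 0) (b := n) (b' := n) (by omega) le_rfl (by
      intro m h1 _ h2
      by_cases h3 : m ∈ p.EL L
      · exact Or.inr h3
      · left
        refine ⟨h1, hL _ _ _ ?_⟩
        intro i hi
        have : p.x (m + i) = p.C (p.F (Nat.sqrt m)) := by
          by_contra h4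
          exact h3 ⟨i, hi, h4⟩
        rw [this, show p.F (Nat.sqrt m) = c from h2]
        rfl)
  have e3 := cnt_union (visits p.x (sball (p.cst c) ε)) (p.EL L) 0 n
  omega

lemma vis_ge' (c : Bool) {ε : ℝ} (hε : 0 < ε) : ∀ᶠ n : ℕ in atTop,
    (1 / 8 : ℝ) * n ≤ cnt (p.G c) 0 n →
    (1 / 16 : ℝ) * n ≤ cnt (visits p.x (sball (p.cst c) ε)) 0 n := by
  obtain ⟨L, hL⟩ := p.vis_ge c hε
  filter_upwards [p.uNull_EL L (1 / 32) (by norm_num), ev_mul (show (0 : ℝ) < 1 / 32 by norm_num) 1]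
    with n h1 h2 h3
  have : (cnt (p.G c) 0 n : ℝ) ≤
      cnt (visits p.x (sball (p.cst c) ε)) 0 n + cnt (p.EL L) 0 n + 1 := by exact_mod_cast hL n
  linarith

lemma cst_ud {c : Bool} (h : p.Hup c) : p.cst c ∈ statOmega upperDensity p.x := by
  intro ε hε
  apply ud_pos (c := 1 / 16) (by norm_num)
  exact ((p.up_cnt h).and_eventually (p.vis_ge' c hε)).mono (fun n h => h.2 h.1)

lemma cst_ld {c : Bool} (h : ∀ w, p.F (2 * w) = c ∨ p.F (2 * w + 1) = c) :
    p.cst c ∈ statOmega lowerDensity p.x := by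
  intro ε hε
  apply ld_pos (c := 1 / 16) (by norm_num)
  filter_upwards [p.low_cnt h, p.vis_ge' c hε] with n h1 h2 using h2 h1

lemma stage_sqrt {n j : ℕ} (h1 : p.N j ≤ n) (h2 : n < p.N (j + 1)) :
    2 * p.M j ≤ Nat.sqrt n ∧ Nat.sqrt n < 2 * p.M (j + 1) :=
  ⟨Nat.le_sqrt'.2 h1, Nat.sqrt_lt'.2 h2⟩

lemma x_of_not_EL {n L i : ℕ} (h : n ∉ p.EL L) (hi : i < L) :
    p.x (n + i) = p.C (p.F (Nat.sqrt n)) := by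
  by_contra h4
  exact h ⟨i, hi, h4⟩

lemma cst_not_ld {c : Bool}
    (h : ∃ᶠ j in atTop, ∀ m, 2 * p.M j ≤ m → m < 2 * p.M (j + 1) → p.F m ≠ c) :
    p.cst c ∉ statOmega lowerDensity p.x := by
  intro hm
  have h1 := hm ((1 / 2) ^ 1) (half_pow_pos 1)
  rw [ld_zero (p.freq_small (p.uNull_EL 1) ?_)] at h1
  · exact lt_irrefl _ h1
  · refine h.mono ?_
    intro j hj n h2 h3 h4
    by_contra h5
    have h6 := visits_imp h4 0 (by norm_num)
    rw [p.x_of_not_EL h5 (by norm_num)] at h6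
    exact hj _ (p.stage_sqrt h2 h3).1 (p.stage_sqrt h2 h3).2 (p.C_inj h6)

def K : Set (ℕ → Fin k) := {z | ∃ s, z = p.cst s}

lemma K_fin : p.K.Finite := by
  refine (Set.finite_range p.cst).subset ?_
  rintro z ⟨s, rfl⟩
  exact ⟨s, rfl⟩

lemma K_sub_Y : p.K ⊆ p.Y := fun _ h => Or.inl h

lemma Y_fin : p.Y.Finite := by
  refine (p.K_fin.union ((Set.finite_Iio 2).image p.al)).subset ?_
  rintro z (h | ⟨_, s, hs, rfl⟩)
  · exact Or.inl h
  · exact Or.inr ⟨s, hs, rfl⟩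

lemma not_K {z : ℕ → Fin k} (hz : z ∉ p.K) : ∃ ε > (0 : ℝ), UNull (visits p.x (sball z ε)) := by
  obtain ⟨L, hL⟩ := fin_sep p.K_fin hz
  refine ⟨(1 / 2) ^ L, half_pow_pos L, (p.uNull_EL L).mono ?_⟩
  intro n hn
  by_contra h
  obtain ⟨i, hi, hne⟩ := hL (p.cst (p.F (Nat.sqrt n))) ⟨_, rfl⟩
  apply hne
  rw [← visits_imp hn i hi, p.x_of_not_EL h hi]
  rfl

lemma ud_sub : statOmega upperDensity p.x ⊆ p.K := by
  intro z hz
  by_contra h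
  obtain ⟨ε, hε, hN⟩ := p.not_K h
  have := hz ε hε
  rw [hN.ud] at this
  exact lt_irrefl _ this

lemma ld_sub : statOmega lowerDensity p.x ⊆ p.K := by
  intro z hz
  by_contra h
  obtain ⟨ε, hε, hN⟩ := p.not_K h
  have := hz ε hε
  rw [ld_zero (fun ε hε => (hN ε hε).frequently)] at this
  exact lt_irrefl _ this

lemma bud_sub : statOmega banachUpperDensity p.x ⊆ p.Y := by
  intro z hz
  by_contra h
  obtain ⟨L, hL⟩ := fin_sep p.Y_fin h
  have h1 := hz ((1 / 2) ^ L) (half_pow_pos L)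
  rw [((p.bNull_T L).mono ?_).bud] at h1
  · exact lt_irrefl _ h1
  · intro n hn y hy h2
    obtain ⟨i, hi, hne⟩ := hL y hy
    apply hne
    rw [← visits_imp hn i hi, h2 i hi]

lemma run_cst {c : Bool} (h : p.Hup c) (L : ℕ) : ∃ n ≥ 1, ∀ i < L, p.x (n + i) = p.cst c i := by
  obtain ⟨n, h1, h2, h3⟩ := ((p.up_cnt h).and_eventually
    ((p.uNull_EL L (1 / 32) (by norm_num)).and
      (ev_mul (show (0 : ℝ) < 1 / 32 by norm_num) 1))).exists
  by_contra hcon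
  push Not at hcon
  have s := cnt_split (p.G c) 0 1 n
  have e1 := cnt_le (p.G c) 0 1
  have e2 := cnt_mono (S := p.G c) (S' := p.EL L) (a := 1) (a' := 0) (b := n) (b' := n) (by omega)
    le_rfl (by
      intro m g1 _ g2
      obtain ⟨i, hi, hne⟩ := hcon m g1
      refine ⟨i, hi, ?_⟩
      rw [show p.F (Nat.sqrt m) = c from g2]
      exact hne)
  have e3 : (cnt (p.G c) 0 n : ℝ) ≤ cnt (p.EL L) 0 n + 1 := by
    exact_mod_cast (show cnt (p.G c) 0 n ≤ cnt (p.EL L) 0 n + 1 by omega)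
  linarith

lemma run_al (he : p.e = true) {s : ℕ} (hs : s < 2) (L : ℕ) :
    ∃ n ≥ 1, ∀ i < L, p.x (n + i) = p.al s i := by
  obtain ⟨m, hm⟩ : ∃ m, m = 3 * p.M (L + 1) := ⟨_, rfl⟩
  have hmL : L ≤ m := by
    have := Nat.self_le_factorial (L + 1 + p.c)
    have : p.M (L + 1) = (L + 1 + p.c).factorial := rfl
    omega
  have hMp := p.M_pos (L + 1)
  have hMg := p.M_grow (L + 1)
  obtain ⟨t, ht⟩ : ∃ t, t = (m ^ 2 + s) % 2 := ⟨_, rfl⟩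
  have r : (m + 1) ^ 2 = m ^ 2 + (2 * m + 1) := by ring
  have hm2 : 0 < m ^ 2 := by have : 0 < m := by omega
                             positivity
  refine ⟨m ^ 2 + t, by omega, ?_⟩
  intro i hi
  have hlt : m ^ 2 + t + i < (m + 1) ^ 2 := by omega
  have hsq : Nat.sqrt (m ^ 2 + t + i) = m := by
    apply le_antisymm
    · exact Nat.lt_succ_iff.1 (Nat.sqrt_lt'.2 hlt)
    · exact Nat.le_sqrt'.2 (by omega)
  have hN1 : p.N (L + 1) = (2 * p.M (L + 1)) ^ 2 := rfl
  have hN2 : p.N (L + 2) = (2 * p.M (L + 2)) ^ 2 := rfl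
  have b1 : p.N (L + 1) + p.N L ≤ m ^ 2 := by
    have := p.N_grow L
    rw [hm]
    nlinarith
  have b2 : (m + 1) ^ 2 ≤ p.N (L + 2) := by
    rw [hN2]
    apply Nat.pow_le_pow_left
    rw [show L + 1 + 1 = L + 2 from rfl] at hMg
    omega
  rw [p.x_main (j := L) (by omega) (by omega), hsq, col, if_pos ⟨he, L, hm⟩, al, alt, alt]
  congr 2
  omega

lemma run_Y (h : ∀ c, p.Hup c) {y : ℕ → Fin k} (hy : y ∈ p.Y) (L : ℕ) :
    ∃ n ≥ 1, ∀ i < L, p.x (n + i) = y i := by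
  rcases hy with ⟨s, rfl⟩ | ⟨he, s, hs, rfl⟩
  · exact p.run_cst (h s) L
  · exact p.run_al he hs L

lemma per_Y {y : ℕ → Fin k} (hy : y ∈ p.Y) (j i : ℕ) : y (2 * j + i) = y i := by
  rcases hy with ⟨s, rfl⟩ | ⟨he, s, hs, rfl⟩
  · rfl
  · simp only [al, alt]
    congr 2
    omega

lemma bud_sup (h : ∀ c, p.Hup c) : p.Y ⊆ statOmega banachUpperDensity p.x := by
  intro y hy ε hε
  obtain ⟨L, hL⟩ := exists_vis hε
  apply bud_pos (c := 1 / 2) (by norm_num)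
  filter_upwards with N
  obtain ⟨n, hn, hr⟩ := p.run_Y h hy (N + L)
  refine ⟨n, ?_⟩
  have : N ≤ 2 * cnt (visits p.x (sball y ε)) n (n + N) := by
    apply cnt_even
    intro i hi
    refine ⟨by omega, hL _ _ _ ?_⟩
    intro t ht
    rw [add_assoc, hr _ (by omega), p.per_Y hy]
  have h' : (N : ℝ) ≤ 2 * cnt (visits p.x (sball y ε)) n (n + N) := by exact_mod_cast this
  linarith

lemma Y_sub_omega (h : ∀ c, p.Hup c) : p.Y ⊆ omegaLim p.x := by
  intro y hy ε hε N
  obtain ⟨L, hL⟩ := exists_vis hε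
  obtain ⟨n, hn, hr⟩ := p.run_Y h hy (2 * N + L)
  refine ⟨n + 2 * N, by omega, hL _ _ _ ?_⟩
  intro t ht
  rw [add_assoc, hr _ (by omega), p.per_Y hy]

lemma bld_empty (h : ∀ c, p.Hup c) : statOmega banachLowerDensity p.x = ∅ := by
  rw [Set.eq_empty_iff_forall_notMem]
  intro y hy
  obtain ⟨c, hc⟩ : ∃ c, p.C c ≠ y 0 := by
    by_contra hh
    push Not at hh
    have := p.C_inj ((hh true).trans (hh false).symm)
    simp at this
  have h1 := hy ((1 / 2) ^ 1) (half_pow_pos 1)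
  rw [bld_zero] at h1
  · exact lt_irrefl _ h1
  · intro N
    obtain ⟨n, _, hr⟩ := p.run_cst (h c) N
    refine ⟨n, cnt_empty ?_⟩
    intro m h2 h3 h4
    have h5 := visits_imp h4 0 (by norm_num)
    have h6 := hr (m - n) (by omega)
    rw [show n + (m - n) = m + 0 by omega, h5] at h6
    exact hc h6.symm

lemma x_rec (j i : ℕ) (hi : i < p.N j) : p.x (p.N (j + 1) + i) = p.x i := by
  rw [p.x_copy (j := j) (by omega) (by omega)]
  congr 1
  omega

lemma x_omega : p.x ∈ omegaLim p.x := by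
  intro ε hε N
  obtain ⟨L, hL⟩ := exists_vis hε
  have h1 := p.id_le_N (L + N)
  have h2 := p.id_le_N (L + N + 1)
  exact ⟨p.N (L + N + 1), by omega, hL _ _ _ (fun i hi => p.x_rec (L + N) i (by omega))⟩

lemma x_recurrent : Recurrent p.x := by
  intro ε hε
  obtain ⟨n, h1, h2⟩ := p.x_omega ε hε 1
  exact ⟨n, h1, h2⟩

lemma ud_eq_K (h : ∀ c, p.Hup c) : statOmega upperDensity p.x = p.K := by
  apply Set.Subset.antisymm p.ud_sub
  rintro _ ⟨s, rfl⟩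
  exact p.cst_ud (h s)

lemma bud_eq_Y (h : ∀ c, p.Hup c) : statOmega banachUpperDensity p.x = p.Y :=
  Set.Subset.antisymm p.bud_sub (p.bud_sup h)

lemma last_strict (h : ∀ c, p.Hup c) (hx : p.x ∉ p.Y) :
    statOmega banachUpperDensity p.x ⊂ omegaLim p.x := by
  rw [p.bud_eq_Y h]
  exact ⟨p.Y_sub_omega h, fun hh => hx (hh p.x_omega)⟩

lemma not_BR (h : ∀ c, p.Hup c) (hx : p.x ∉ p.Y) : ¬ BanachRecurrent p.x := by
  intro hb
  have : p.x ∈ statOmega banachUpperDensity p.x := hb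
  rw [p.bud_eq_Y h] at this
  exact hx this

lemma Y_false (he : p.e = false) : p.Y = p.K := by
  ext z
  simp [Y, K, he]

lemma K_ssub_Y (he : p.e = true) : p.K ⊂ p.Y := by
  refine ⟨p.K_sub_Y, fun hh => ?_⟩
  obtain ⟨s, hs⟩ := hh (show p.al 0 ∈ p.Y from Or.inr ⟨he, 0, by norm_num, rfl⟩)
  have h0 := congrFun hs 0
  have h1 := congrFun hs 1
  have : p.al 0 0 = p.al 0 1 := by rw [h0, h1]; rfl
  exact p.hab (by simpa [al, alt] using this)

lemma K_nonempty : p.K.Nonempty := ⟨_, true, rfl⟩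

/-! ### DC1 pairs -/

lemma dc1 {p q : Par k} (hCC : p.C = q.C)
    (hd : ∃ᶠ j in atTop, ∀ m, 2 * p.M j ≤ m → m < 2 * p.M (j + 1) → p.F m ≠ q.F m)
    (hs : ∃ᶠ j in atTop, ∀ m, 2 * p.M j ≤ m → m < 2 * p.M (j + 1) → p.F m = q.F m) :
    DC1Pair p.x q.x := by
  have hphi : ∀ n t, PhiN p.x q.x n t =
      (cnt {i | shiftDist (shift^[i] p.x) (shift^[i] q.x) < t} 0 (0 + n) : ℝ) / n := by
    intro n t
    unfold PhiN cnt
    congr 3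
    ext i
    simp [and_comm]
  constructor
  · refine ⟨(1 / 2) ^ 1, half_pow_pos 1, ?_⟩
    simp only [hphi]
    apply li_zero (fun n => frac_nonneg _ 0 n) (fun n => frac_le_one _ 0 n)
    intro ε hε
    refine (p.freq_small (R := {i | shiftDist (shift^[i] p.x) (shift^[i] q.x) < (1 / 2) ^ 1})
      ((p.uNull_EL 1).union (q.uNull_EL 1)) (hd.mono ?_) ε hε).mono ?_
    · intro j hj n h1 h2 h3
      by_contra h4
      rw [Set.mem_union, not_or] at h4
      have h5 := agree_of_dist h3 0 (by norm_num)
      rw [shift_iter, shift_iter, p.x_of_not_EL h4.1 (by norm_num),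
        q.x_of_not_EL h4.2 (by norm_num), ← hCC] at h5
      exact hj _ (p.stage_sqrt h1 h2).1 (p.stage_sqrt h1 h2).2 (p.C_inj h5)
    · intro n hn
      rw [zero_add]
      exact div_le_of hε.le hn
  · intro t ht
    simp only [hphi]
    apply ls_one (fun n => frac_nonneg _ 0 n) (fun n => frac_le_one _ 0 n)
    intro ε hε
    obtain ⟨L, hL⟩ := exists_L ht
    refine ((p.freq_small (R := {i | shiftDist (shift^[i] p.x) (shift^[i] q.x) < t}ᶜ)
      ((p.uNull_EL L).union (q.uNull_EL L)) (hs.mono ?_) ε hε).and_eventually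
        (eventually_gt_atTop 0)).mono ?_
    · intro j hj n h1 h2 h3
      by_contra h4
      rw [Set.mem_union, not_or] at h4
      apply h3
      apply hL
      intro i hi
      rw [shift_iter, shift_iter, p.x_of_not_EL h4.1 hi, q.x_of_not_EL h4.2 hi, ← hCC,
        hj _ (p.stage_sqrt h1 h2).1 (p.stage_sqrt h1 h2).2]
    · rintro n ⟨hn, hn0⟩
      set S := {i | shiftDist (shift^[i] p.x) (shift^[i] q.x) < t}
      have h1 := cnt_union S Sᶜ 0 n
      rw [Set.union_compl_self, cnt_full (S := Set.univ) (fun _ _ _ => Set.mem_univ _)] at h1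
      have h2 : (n : ℝ) ≤ cnt S 0 n + cnt Sᶜ 0 n := by
        exact_mod_cast (show n ≤ cnt S 0 n + cnt Sᶜ 0 n by omega)
      rw [zero_add, le_div_iff₀ (by exact_mod_cast hn0)]
      linarith

end Par

/-! ### Final assembly -/

noncomputable def st (c m : ℕ) : ℕ := sInf {j | m < 2 * (j + 1 + c).factorial}

lemma st_eq {c m j : ℕ} (h1 : 2 * (j + c).factorial ≤ m) (h2 : m < 2 * (j + 1 + c).factorial) :
    st c m = j := by
  apply le_antisymm
  · exact Nat.sInf_le h2
  · apply le_csInf ⟨j, h2⟩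
    intro i hi
    by_contra hlt
    have h3 : (i + 1 + c).factorial ≤ (j + c).factorial := Nat.factorial_le (by omega)
    have h4 : m < 2 * (i + 1 + c).factorial := hi
    omega

lemma st_pair (c w : ℕ) : st c (2 * w + 1) = st c (2 * w) := by
  unfold st
  congr 1
  ext j
  simp only [Set.mem_setOf_eq]
  omega

def bitv (α : ℕ → Bool) (j : ℕ) : Bool := α (Nat.unpair (j / 2)).1

def Hval (κ : ℕ) (α : ℕ → Bool) (j m : ℕ) : Bool :=
  if κ = 0 then xor (if j % 2 = 1 then bitv α j else false) (decide (m % 2 = 1))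
  else if κ = 1 then (if j % 2 = 1 then bitv α j else decide (j % 4 = 2))
  else (if j % 2 = 1 then xor (bitv α j) (decide (m % 2 = 1)) else false)

lemma Hval_even (κ : ℕ) (α β : ℕ → Bool) {j : ℕ} (hj : j % 2 = 0) (m : ℕ) :
    Hval κ α j m = Hval κ β j m := by
  unfold Hval
  simp [hj]

lemma Hval_odd (κ : ℕ) {α β : ℕ → Bool} {j : ℕ} (hj : j % 2 = 1) (h : bitv α j ≠ bitv β j)
    (m : ℕ) : Hval κ α j m ≠ Hval κ β j m := by
  unfold Hval
  simp only [hj, if_true]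
  split_ifs
  · simpa using h
  · exact h
  · simpa using h

lemma freq_of (f : ℕ → ℕ) (hf : ∀ r, r ≤ f r) {P : ℕ → Prop} (h : ∀ r, P (f r)) :
    ∃ᶠ j in atTop, P j :=
  frequently_atTop.2 fun a => ⟨f a, hf a, h a⟩

noncomputable def mkP {k : ℕ} (hk : 2 ≤ k) (κ : ℕ) (e : Bool) (α : ℕ → Bool) (z : ℕ → Fin k)
    (len : ℕ) : Par k where
  a := ⟨0, by omega⟩
  b := ⟨1, by omega⟩
  hab := by simp
  c := len + 4
  hc := by omega
  init := fun i => if i < len then z i else if i = len + 2 then ⟨1, by omega⟩ else ⟨0, by omega⟩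
  e := e
  F := fun m => Hval κ α (st (len + 4) m) m

section
variable {k : ℕ} (hk : 2 ≤ k) (κ : ℕ) (e : Bool) (α : ℕ → Bool) (z : ℕ → Fin k) (len : ℕ)

lemma mkP_F {j m : ℕ} (h1 : 2 * (mkP hk κ e α z len).M j ≤ m)
    (h2 : m < 2 * (mkP hk κ e α z len).M (j + 1)) :
    (mkP hk κ e α z len).F m = Hval κ α j m := by
  have : st (len + 4) m = j := st_eq h1 h2
  change Hval κ α (st (len + 4) m) m = _
  rw [this]

lemma mkP_N0 : len + 3 < (mkP hk κ e α z len).N 0 := by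
  have h : (0 + (len + 4)) ≤ (0 + (len + 4)).factorial := Nat.self_le_factorial _
  change len + 3 < (2 * (0 + (len + 4)).factorial) ^ 2
  nlinarith

lemma mkP_agree : agree len z (mkP hk κ e α z len).x := by
  intro i hi
  have := mkP_N0 hk κ e α z len
  rw [Par.x_init _ (by omega)]
  simp [mkP, hi]

lemma mkP_notY : (mkP hk κ e α z len).x ∉ (mkP hk κ e α z len).Y := by
  have hN := mkP_N0 hk κ e α z len
  have h0 : (mkP hk κ e α z len).x len = ⟨0, by omega⟩ := by
    rw [Par.x_init _ (by omega)]; simp [mkP]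
  have h1 : (mkP hk κ e α z len).x (len + 1) = ⟨0, by omega⟩ := by
    rw [Par.x_init _ (by omega)]; simp [mkP]
  have h2 : (mkP hk κ e α z len).x (len + 2) = ⟨1, by omega⟩ := by
    rw [Par.x_init _ (by omega)]; simp [mkP]
  rintro (⟨s, hs⟩ | ⟨-, s, -, hs⟩)
  · rw [hs] at h0 h2
    have := h0.symm.trans h2
    simp at this
  · rw [hs] at h0 h2
    have h3 : (mkP hk κ e α z len).al s (len + 2) = (mkP hk κ e α z len).al s len := by
      unfold Par.al Par.alt
      rw [show (len + 2 + s) % 2 = (len + s) % 2 by omega]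
    rw [h3, h0] at h2
    simp at h2

lemma mkP_F2 (w : ℕ) : (mkP hk κ e α z len).F (2 * w) = Hval κ α (st (len + 4) (2 * w)) (2 * w) ∧
    (mkP hk κ e α z len).F (2 * w + 1) = Hval κ α (st (len + 4) (2 * w)) (2 * w + 1) := by
  refine ⟨rfl, ?_⟩
  change Hval κ α (st (len + 4) (2 * w + 1)) (2 * w + 1) = _
  rw [st_pair]

lemma both0 (c : Bool) (w : ℕ) : (mkP hk 0 e α z len).F (2 * w) = c ∨
    (mkP hk 0 e α z len).F (2 * w + 1) = c := by
  rw [(mkP_F2 hk 0 e α z len w).1, (mkP_F2 hk 0 e α z len w).2]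
  unfold Hval
  have h1 : (2 * w) % 2 = 0 := by omega
  have h2 : (2 * w + 1) % 2 = 1 := by omega
  simp only [h1, h2, if_true]
  generalize (if st (len + 4) (2 * w) % 2 = 1 then bitv α (st (len + 4) (2 * w)) else false) = v
  cases v <;> cases c <;> simp

lemma false2 (w : ℕ) : (mkP hk 2 e α z len).F (2 * w) = false ∨
    (mkP hk 2 e α z len).F (2 * w + 1) = false := by
  rw [(mkP_F2 hk 2 e α z len w).1, (mkP_F2 hk 2 e α z len w).2]
  unfold Hval
  have h1 : (2 * w) % 2 = 0 := by omega
  have h2 : (2 * w + 1) % 2 = 1 := by omega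
  simp only [h1, h2, if_true]
  generalize bitv α (st (len + 4) (2 * w)) = v
  split_ifs <;> cases v <;> simp_all

lemma hup_of {c : Bool} (f : ℕ → ℕ) (hf : ∀ r, r ≤ f r)
    (h : ∀ r w, Hval κ α (f r) (2 * w) = c ∨ Hval κ α (f r) (2 * w + 1) = c) :
    (mkP hk κ e α z len).Hup c := by
  refine freq_of f hf fun r w h1 h2 => ?_
  rw [mkP_F hk κ e α z len (j := f r) (by omega) (by omega),
    mkP_F hk κ e α z len (j := f r) (by omega) (by omega)]
  exact h r w

lemma notld_of {c : Bool} (f : ℕ → ℕ) (hf : ∀ r, r ≤ f r)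
    (h : ∀ r m, Hval κ α (f r) m ≠ c) :
    (mkP hk κ e α z len).cst c ∉ statOmega lowerDensity (mkP hk κ e α z len).x := by
  refine Par.cst_not_ld _ (freq_of f hf fun r m h1 h2 => ?_)
  rw [mkP_F hk κ e α z len h1 h2]
  exact h r m

lemma hup0 (c : Bool) : (mkP hk 0 e α z len).Hup c :=
  freq_of id (fun _ => le_rfl) fun _ w _ _ => both0 hk e α z len c w

lemma hval1_0 (r m : ℕ) : Hval 1 α (4 * r) m = false := by
  unfold Hval
  have h1 : (4 * r) % 2 = 0 := by omega
  have h2 : (4 * r) % 4 = 0 := by omega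
  simp [h1, h2]

lemma hval1_2 (r m : ℕ) : Hval 1 α (4 * r + 2) m = true := by
  unfold Hval
  have h1 : (4 * r + 2) % 2 = 0 := by omega
  have h2 : (4 * r + 2) % 4 = 2 := by omega
  simp [h1, h2]

lemma hup1 (c : Bool) : (mkP hk 1 e α z len).Hup c := by
  cases c
  · exact hup_of hk 1 e α z len (fun r => 4 * r) (fun r => by omega)
      fun r w => Or.inl (hval1_0 α r _)
  · exact hup_of hk 1 e α z len (fun r => 4 * r + 2) (fun r => by omega)
      fun r w => Or.inl (hval1_2 α r _)

lemma hup2 (c : Bool) : (mkP hk 2 e α z len).Hup c := by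
  refine hup_of hk 2 e α z len (fun r => 2 * r + 1) (fun r => by omega) fun r w => ?_
  unfold Hval
  have h1 : (2 * w) % 2 = 0 := by omega
  have h2 : (2 * w + 1) % 2 = 1 := by omega
  have h3 : (2 * r + 1) % 2 = 1 := by omega
  simp only [h1, h2, h3, if_true]
  generalize bitv α (2 * r + 1) = v
  cases v <;> cases c <;> simp

lemma ld0 : statOmega lowerDensity (mkP hk 0 e α z len).x = (mkP hk 0 e α z len).K := by
  apply Set.Subset.antisymm (Par.ld_sub _)
  rintro _ ⟨s, rfl⟩
  exact Par.cst_ld _ (both0 hk e α z len s)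

lemma ld1 : statOmega lowerDensity (mkP hk 1 e α z len).x = ∅ := by
  rw [Set.eq_empty_iff_forall_notMem]
  intro y hy
  obtain ⟨s, rfl⟩ := Par.ld_sub _ hy
  revert hy
  cases s
  · exact notld_of hk 1 e α z len (fun r => 4 * r + 2) (fun r => by omega)
      fun r m => by simp [hval1_2]
  · exact notld_of hk 1 e α z len (fun r => 4 * r) (fun r => by omega)
      fun r m => by simp [hval1_0]

lemma ld2_ne : (statOmega lowerDensity (mkP hk 2 e α z len).x).Nonempty :=
  ⟨_, Par.cst_ld _ (false2 hk e α z len)⟩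

lemma ld2_ss : statOmega lowerDensity (mkP hk 2 e α z len).x ⊂ (mkP hk 2 e α z len).K := by
  refine Set.ssubset_iff_subset_ne.2 ⟨Par.ld_sub _, fun h => ?_⟩
  have h1 : (mkP hk 2 e α z len).cst true ∈ (mkP hk 2 e α z len).K := ⟨true, rfl⟩
  rw [← h] at h1
  refine notld_of hk 2 e α z len (fun r => 2 * r) (fun r => by omega) (fun r m => ?_) h1
  unfold Hval
  have h3 : (2 * r) % 2 = 0 := by omega
  simp [h3]

end

def kap : Fin 6 → ℕ := ![0, 0, 1, 2, 1, 2]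

def eps : Fin 6 → Bool := ![false, true, false, false, true, true]

section
variable {k : ℕ} (hk : 2 ≤ k) (i : Fin 6) (α : ℕ → Bool) (z : ℕ → Fin k) (len : ℕ)

lemma mem_case : ((Recurrent (mkP hk (kap i) (eps i) α z len).x ∧
    ¬ BanachRecurrent (mkP hk (kap i) (eps i) α z len).x) ∧
    SatCase' i (mkP hk (kap i) (eps i) α z len).x) := by
  have hY := mkP_notY hk (kap i) (eps i) α z len
  have hup : ∀ c, (mkP hk (kap i) (eps i) α z len).Hup c := by
    intro c
    fin_cases i
    · exact hup0 hk _ α z len c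
    · exact hup0 hk _ α z len c
    · exact hup1 hk _ α z len c
    · exact hup2 hk _ α z len c
    · exact hup1 hk _ α z len c
    · exact hup2 hk _ α z len c
  refine ⟨⟨Par.x_recurrent _, Par.not_BR _ hup hY⟩, ?_⟩
  refine ⟨?_, ?_, ?_, Par.last_strict _ hup hY⟩
  · rw [Par.bld_empty _ hup]
    fin_cases i
    · change ∅ ⊂ statOmega lowerDensity (mkP hk 0 _ α z len).x
      rw [ld0, Set.empty_ssubset]; exact Par.K_nonempty _
    · change ∅ ⊂ statOmega lowerDensity (mkP hk 0 _ α z len).x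
      rw [ld0, Set.empty_ssubset]; exact Par.K_nonempty _
    · exact (ld1 hk _ α z len).symm
    · exact Set.empty_ssubset.2 (ld2_ne hk _ α z len)
    · exact (ld1 hk _ α z len).symm
    · exact Set.empty_ssubset.2 (ld2_ne hk _ α z len)
  · rw [Par.ud_eq_K _ hup]
    fin_cases i
    · exact ld0 hk _ α z len
    · exact ld0 hk _ α z len
    · change statOmega lowerDensity (mkP hk 1 _ α z len).x ⊂ _
      rw [ld1, Set.empty_ssubset]; exact Par.K_nonempty _
    · exact ld2_ss hk _ α z len
    · change statOmega lowerDensity (mkP hk 1 _ α z len).x ⊂ _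
      rw [ld1, Set.empty_ssubset]; exact Par.K_nonempty _
    · exact ld2_ss hk _ α z len
  · rw [Par.ud_eq_K _ hup, Par.bud_eq_Y _ hup]
    fin_cases i
    · exact (Par.Y_false _ rfl).symm
    · exact Par.K_ssub_Y _ rfl
    · exact (Par.Y_false _ rfl).symm
    · exact (Par.Y_false _ rfl).symm
    · exact Par.K_ssub_Y _ rfl
    · exact Par.K_ssub_Y _ rfl

end

lemma mkP_dc1 {k : ℕ} (hk : 2 ≤ k) (κ : ℕ) (e : Bool) (z : ℕ → Fin k) (len : ℕ)
    {α β : ℕ → Bool} (h : α ≠ β) : DC1Pair (mkP hk κ e α z len).x (mkP hk κ e β z len).x := by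
  obtain ⟨n, hn⟩ := Function.ne_iff.1 h
  refine Par.dc1 rfl ?_ ?_
  · refine freq_of (fun r => 2 * Nat.pair n r + 1)
      (fun r => by have := Nat.right_le_pair n r; omega) fun r m h1 h2 => ?_
    rw [mkP_F hk κ e α z len h1 h2, mkP_F hk κ e β z len h1 h2]
    apply Hval_odd κ (by omega)
    unfold bitv
    rw [show (2 * Nat.pair n r + 1) / 2 = Nat.pair n r by omega, Nat.unpair_pair]
    exact hn
  · refine freq_of (fun r => 2 * r) (fun r => by omega) fun r m h1 h2 => ?_
    rw [mkP_F hk κ e α z len h1 h2, mkP_F hk κ e β z len h1 h2]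
    exact Hval_even κ α β (by omega) m

lemma DC1Pair.ne {k : ℕ} {x y : ℕ → Fin k} (h : DC1Pair x y) : x ≠ y := by
  rintro rfl
  obtain ⟨⟨s, hs, h0⟩, -⟩ := h
  have h1 : (fun n => PhiN x x n s) =ᶠ[atTop] fun _ => (1 : ℝ) := by
    filter_upwards [eventually_gt_atTop 0] with n hn
    have h2 : {i | i < n ∧ shiftDist (shift^[i] x) (shift^[i] x) < s} = Set.Iio n := by
      ext i
      simp [shiftDist, hs]
    unfold PhiN
    rw [h2]
    have h3 : (Set.Iio n).ncard = n := by
      rw [← Finset.coe_range, Set.ncard_coe_finset, Finset.card_range]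
    rw [h3]
    exact div_self (by exact_mod_cast hn.ne')
  rw [liminf_congr h1, liminf_const] at h0
  exact one_ne_zero h0

lemma bool_seq_unc : ¬ (Set.univ : Set (ℕ → Bool)).Countable := by
  rw [Set.countable_univ_iff]
  intro h
  obtain ⟨f, hf⟩ := exists_surjective_nat (ℕ → Bool)
  obtain ⟨n, hn⟩ := hf (fun n => !(f n n))
  have := congrFun hn n
  simp at this

/-- **Theorem B.** For `k ≥ 2` and each `i = 1,…,6`, the set of points of `Σ_k` that are
recurrent but not Banach recurrent and satisfy Case (i') is dense in `Σ_k` and contains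
an uncountable DC1-scrambled subset. -/
theorem case_prime_dense_and_DC1 (k : ℕ) (hk : 2 ≤ k) (i : Fin 6) :
    ShiftDense {x : ℕ → Fin k | (Recurrent x ∧ ¬ BanachRecurrent x) ∧ SatCase' i x} ∧
    ∃ S : Set (ℕ → Fin k),
      S ⊆ {x | (Recurrent x ∧ ¬ BanachRecurrent x) ∧ SatCase' i x} ∧
      ¬ S.Countable ∧ DC1Scrambled S := by
  constructor
  · intro z ε hε
    obtain ⟨L, hL⟩ := exists_L hε
    exact ⟨_, mem_case hk i (fun _ => false) z L, hL _ _ (mkP_agree hk _ _ _ z L)⟩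
  · have hz : Fin k := ⟨0, by omega⟩
    set f : (ℕ → Bool) → (ℕ → Fin k) :=
      fun α => (mkP hk (kap i) (eps i) α (fun _ => hz) 0).x with hf
    have hdc : ∀ {α β}, α ≠ β → DC1Pair (f α) (f β) := fun h => mkP_dc1 hk _ _ _ 0 h
    have hinj : Function.Injective f := by
      intro α β h
      by_contra hne
      exact (hdc hne).ne h
    refine ⟨Set.range f, ?_, ?_, ?_, ?_⟩
    · rintro _ ⟨α, rfl⟩
      exact mem_case hk i α _ 0
    · intro hc
      apply bool_seq_unc
      rw [← Set.image_univ] at hc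
      exact (Set.countable_of_injective_of_countable_image hinj.injOn hc)
    · refine ⟨f (fun _ => false), ⟨_, rfl⟩, f (fun _ => true), ⟨_, rfl⟩, fun h => ?_⟩
      have := congrFun (hinj h) 0
      simp at this
    · rintro _ ⟨α, rfl⟩ _ ⟨β, rfl⟩ hne
      exact hdc (fun h => hne (by rw [h]))
end

section
/- Let (X,d) be a compact metric space, f : X → X continuous, x ∈ X, and Λ = ω_f(x) its ω-limit set. Then the measure center C(Λ, f|_Λ) equals the closure of the set {y ∈ Λ : d̲(N(y, B_ε(y))) > 0 for every ε > 0} (the set of weakly almost periodic points of (Λ, f|_Λ)). -/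
open Filter Topology MeasureTheory

/-- `N(y, U) = {n ≥ 1 : f^n(y) ∈ U}`. -/
def visitsF {X : Type*} (f : X → X) (y : X) (U : Set X) : Set ℕ :=
  {n | 1 ≤ n ∧ f^[n] y ∈ U}

/-- The ω-limit set of `x` under `f`: limit points of the forward orbit. -/
def omegaLimF {X : Type*} [MetricSpace X] (f : X → X) (x : X) : Set X :=
  {y | ∀ ε > (0 : ℝ), ∀ N : ℕ, ∃ n ≥ N, dist (f^[n] x) y < ε}

/-- The support of a measure: points all of whose neighbourhoods have positive measure. -/
def msuppX {X : Type*} [MetricSpace X] [MeasurableSpace X] (μ : Measure X) : Set X :=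
  {y | ∀ ε > (0 : ℝ), 0 < μ (Metric.ball y ε)}

/-- `M(Λ, f)`: the `f`-invariant Borel probability measures giving full measure to `Λ`. -/
def invMeasuresOn {X : Type*} [MeasurableSpace X] (f : X → X) (Λ : Set X) :
    Set (Measure X) :=
  {μ | IsProbabilityMeasure μ ∧ μ.map f = μ ∧ μ Λ = 1}

/-- Statistical ω-limit set `ω_ξ(x)` w.r.t. a density notion `ξ`. -/
def statOmegaF {X : Type*} [MetricSpace X] (ξ : Set ℕ → ℝ) (f : X → X) (x : X) : Set X :=
  {y | ∀ ε > (0 : ℝ), 0 < ξ (visitsF f x (Metric.ball y ε))}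

/-- `V(x, f)`: weak* limit points of the sequence of empirical measures
`(1/n) Σ_{i<n} δ_{f^i x}`. -/
def VSetX {X : Type*} [MetricSpace X] [MeasurableSpace X] (f : X → X) (x : X) :
    Set (Measure X) :=
  {μ | IsProbabilityMeasure μ ∧ ∃ φ : ℕ → ℕ, StrictMono φ ∧
    ∀ g : C(X, ℝ),
      Filter.Tendsto (fun j => (∑ i ∈ Finset.range (φ j), g (f^[i] x)) / (φ j : ℝ))
        Filter.atTop (𝓝 (∫ z, g z ∂μ))}

noncomputable def visS {X : Type*} (f : X → X) (A : Set X) (n : ℕ) (y : X) : ℝ :=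
  ∑ i ∈ Finset.range n, A.indicator (fun _ => (1 : ℝ)) (f^[i] y)

lemma visS_add {X : Type*} (f : X → X) (A : Set X) (m n : ℕ) (y : X) :
    visS f A (m + n) y = visS f A m y + visS f A n (f^[m] y) := by
  unfold visS
  rw [Finset.sum_range_add]
  congr 1
  refine Finset.sum_congr rfl fun i _ => ?_
  rw [← Function.iterate_add_apply, add_comm]

lemma visS_le {X : Type*} (f : X → X) (A : Set X) (n : ℕ) (y : X) : visS f A n y ≤ n := by
  unfold visS
  calc _ ≤ ∑ i ∈ Finset.range n, (1 : ℝ) :=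
        Finset.sum_le_sum fun _ _ => Set.indicator_le_self' (fun _ _ => zero_le_one) _
    _ = n := by simp

lemma visS_mono {X : Type*} (f : X → X) {A B : Set X} (h : A ⊆ B) (n : ℕ) (y : X) :
    visS f A n y ≤ visS f B n y :=
  Finset.sum_le_sum fun i _ => Set.indicator_le_indicator_of_subset h (fun _ => zero_le_one) _

def lowSet {X : Type*} (f : X → X) (A : Set X) (δ : ℝ) (M : ℕ) : Set X :=
  {y | y ∈ A ∧ ∃ n, (1 ≤ n ∧ n ≤ M) ∧ visS f A n y ≤ δ * n}

lemma visS_lowSet {X : Type*} (f : X → X) (A : Set X) (δ : ℝ) (hδ : 0 ≤ δ) (M : ℕ) (N : ℕ) :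
    ∀ y, visS f (lowSet f A δ M) N y ≤ δ * N + M := by
  induction N using Nat.strong_induction_on with
  | _ N ih =>
    intro y
    by_cases hN : N ≤ M
    · have h1 := visS_le f (lowSet f A δ M) N y
      have h2 : (N : ℝ) ≤ M := by exact_mod_cast hN
      have : 0 ≤ δ * N := by positivity
      linarith
    push Not at hN
    have key : ∃ n, (1 ≤ n ∧ n ≤ N) ∧ visS f (lowSet f A δ M) n y ≤ δ * n := by
      by_cases hy : y ∈ lowSet f A δ M
      · obtain ⟨_, n, ⟨h1, h2⟩, h3⟩ := hy
        exact ⟨n, ⟨h1, by omega⟩, (visS_mono f (fun z hz => hz.1) n y).trans h3⟩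
      · refine ⟨1, ⟨le_rfl, by omega⟩, ?_⟩
        simp [visS, hy, hδ]
    obtain ⟨n, ⟨h1, h2⟩, h3⟩ := key
    obtain ⟨k, rfl⟩ := Nat.exists_eq_add_of_le h2
    rw [visS_add]
    have := ih k (by omega) (f^[n] y)
    push_cast
    linarith

section meas
variable {X : Type*} [MeasurableSpace X]

lemma measurable_visS {f : X → X} (hf : Measurable f) {A : Set X} (hA : MeasurableSet A) (n : ℕ) :
    Measurable (visS f A n) := by
  unfold visS
  refine Finset.measurable_fun_sum _ fun i _ => ?_
  exact (measurable_const.indicator hA).comp (hf.iterate i)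

lemma measurableSet_lowSet {f : X → X} (hf : Measurable f) {A : Set X} (hA : MeasurableSet A)
    (δ : ℝ) (M : ℕ) : MeasurableSet (lowSet f A δ M) := by
  have : lowSet f A δ M = A ∩ ⋃ n, ⋃ (_ : 1 ≤ n ∧ n ≤ M), {y | visS f A n y ≤ δ * n} := by
    ext y; simp only [lowSet, Set.mem_setOf_eq, Set.mem_inter_iff, Set.mem_iUnion, exists_prop]
  rw [this]
  refine hA.inter (MeasurableSet.iUnion fun n => MeasurableSet.iUnion fun _ => ?_)
  exact measurableSet_le (measurable_visS hf hA n) measurable_const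

lemma integral_visS {f : X → X} {μ : Measure X} [IsProbabilityMeasure μ]
    (hf : MeasurePreserving f μ μ) {G : Set X} (hG : MeasurableSet G) (N : ℕ) :
    Integrable (visS f G N) μ ∧ ∫ y, visS f G N y ∂μ = N * μ.real G := by
  have hi : ∀ i, (fun y => G.indicator (fun _ => (1 : ℝ)) (f^[i] y)) =
      (f^[i] ⁻¹' G).indicator (fun _ => (1 : ℝ)) := fun i => rfl
  have hm : ∀ i, MeasurableSet (f^[i] ⁻¹' G) := fun i => (hf.measurable.iterate i) hG
  have hint : ∀ i, Integrable (fun y => G.indicator (fun _ => (1 : ℝ)) (f^[i] y)) μ := by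
    intro i
    rw [hi]
    exact (integrable_const _).indicator (hm i)
  refine ⟨integrable_finset_sum _ fun i _ => hint i, ?_⟩
  unfold visS
  rw [integral_finset_sum _ fun i _ => hint i]
  have : ∀ i, ∫ y, G.indicator (fun _ => (1 : ℝ)) (f^[i] y) ∂μ = μ.real G := by
    intro i
    rw [hi, integral_indicator_const _ (hm i)]
    simp [Measure.real, (hf.iterate i).measure_preimage hG.nullMeasurableSet]
  simp [this]

lemma measure_lowSet_le {f : X → X} {μ : Measure X} [IsProbabilityMeasure μ]
    (hf : MeasurePreserving f μ μ) {A : Set X} (hA : MeasurableSet A) (δ : ℝ) (hδ : 0 ≤ δ) (M : ℕ) :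
    μ (lowSet f A δ M) ≤ ENNReal.ofReal δ := by
  have hG := measurableSet_lowSet hf.measurable hA δ M
  have hb : ∀ N : ℕ, N * μ.real (lowSet f A δ M) ≤ δ * N + M := by
    intro N
    obtain ⟨h1, h2⟩ := integral_visS hf hG N
    rw [← h2]
    calc _ ≤ ∫ y, (δ * N + M) ∂μ :=
          integral_mono h1 (integrable_const _) (visS_lowSet f A δ hδ M N)
      _ = _ := by simp
  rw [← ofReal_measureReal]
  apply ENNReal.ofReal_le_ofReal
  by_contra! h
  obtain ⟨N, hN⟩ := exists_nat_gt ((M : ℝ) / (μ.real (lowSet f A δ M) - δ))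
  rw [div_lt_iff₀ (by linarith)] at hN
  have := hb N
  nlinarith

lemma ae_good {f : X → X} {μ : Measure X} [IsProbabilityMeasure μ]
    (hf : MeasurePreserving f μ μ) {A : Set X} (hA : MeasurableSet A) :
    ∀ᵐ y ∂μ, y ∈ A → ∃ δ > (0 : ℝ), ∀ n ≥ 1, δ * n < visS f A n y := by
  have hU : ∀ δ > (0 : ℝ), μ (⋃ M, lowSet f A δ M) ≤ ENNReal.ofReal δ := by
    intro δ hδ
    have hmono : Monotone (lowSet f A δ) := by
      rintro M M' h y ⟨hy, n, ⟨h1, h2⟩, h3⟩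
      exact ⟨hy, n, ⟨h1, h2.trans h⟩, h3⟩
    rw [hmono.measure_iUnion]
    exact iSup_le fun M => measure_lowSet_le hf hA δ hδ.le M
  rw [ae_iff]
  refine le_antisymm ?_ bot_le
  refine ENNReal.le_of_forall_pos_le_add fun ε hε _ => ?_
  rw [zero_add]
  calc _ ≤ μ (⋃ M, lowSet f A ε M) := measure_mono ?_
    _ ≤ _ := hU ε (by exact_mod_cast hε)
    _ = _ := by simp
  intro y hy
  simp only [Set.mem_setOf_eq, not_forall] at hy
  obtain ⟨hyA, h⟩ := hy
  push Not at h
  obtain ⟨n, hn, h⟩ := h ε (by exact_mod_cast hε)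
  exact Set.mem_iUnion.2 ⟨n, hyA, n, ⟨hn, le_rfl⟩, h⟩
end meas

lemma visS_eq_ncard {X : Type*} (f : X → X) (A : Set X) (n : ℕ) (y : X) :
    visS f A n y = (({i | f^[i] y ∈ A} ∩ Set.Iio n).ncard : ℝ) := by
  classical
  have : ({i | f^[i] y ∈ A} ∩ Set.Iio n) = ((Finset.range n).filter (fun i => f^[i] y ∈ A) : Finset ℕ) := by
    ext i; simp [and_comm]
  rw [this, Set.ncard_coe_finset]
  simp [visS, Set.indicator_apply]

lemma vis_bounds {X : Type*} (f : X → X) (A : Set X) (n : ℕ) (y : X) :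
    ((visitsF f y A ∩ Set.Iio n).ncard : ℝ) ≤ visS f A n y ∧
    visS f A n y ≤ (visitsF f y A ∩ Set.Iio n).ncard + 1 := by
  rw [visS_eq_ncard]
  have hfin : (Set.Iio n).Finite := Set.finite_Iio n
  constructor
  · have : (visitsF f y A ∩ Set.Iio n).ncard ≤ ({i | f^[i] y ∈ A} ∩ Set.Iio n).ncard := by
      apply Set.ncard_le_ncard _ (hfin.subset Set.inter_subset_right)
      rintro i ⟨⟨_, h⟩, h'⟩
      exact ⟨h, h'⟩
    exact_mod_cast this
  · have h1 : ({i | f^[i] y ∈ A} ∩ Set.Iio n) ⊆ insert 0 (visitsF f y A ∩ Set.Iio n) := by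
      rintro i ⟨h, h'⟩
      rcases Nat.eq_zero_or_pos i with rfl | hi
      · exact Set.mem_insert _ _
      · exact Set.mem_insert_of_mem _ ⟨⟨hi, h⟩, h'⟩
    have h2 := Set.ncard_le_ncard h1 ((hfin.subset Set.inter_subset_right).insert 0)
    have h3 := h2.trans (Set.ncard_insert_le _ _)
    exact_mod_cast h3

lemma dens_bdd (S : Set ℕ) (n : ℕ) :
    0 ≤ ((S ∩ Set.Iio n).ncard : ℝ) / n ∧ ((S ∩ Set.Iio n).ncard : ℝ) / n ≤ 1 := by
  refine ⟨by positivity, div_le_one_of_le₀ ?_ (by positivity)⟩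
  have := Set.ncard_le_ncard (Set.inter_subset_right : S ∩ Set.Iio n ⊆ _) (Set.finite_Iio n)
  have h2 : (Set.Iio n).ncard = n := by simp [Set.ncard_eq_toFinset_card']
  rw [h2] at this
  exact_mod_cast this

lemma lowerDensity_pos_of_ev {S : Set ℕ} {c : ℝ} (hc : 0 < c)
    (h : ∀ᶠ n : ℕ in atTop, c ≤ ((S ∩ Set.Iio n).ncard : ℝ) / n) : 0 < lowerDensity S := by
  refine hc.trans_le ?_
  refine le_liminf_of_le ?_ h
  exact (isBoundedUnder_of ⟨1, fun n => (dens_bdd S n).2⟩ :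
    IsBoundedUnder (· ≤ ·) _ _).isCoboundedUnder_ge

lemma ev_of_lowerDensity_pos {S : Set ℕ} (h : 0 < lowerDensity S) :
    ∃ c > (0 : ℝ), ∀ᶠ n : ℕ in atTop, c < ((S ∩ Set.Iio n).ncard : ℝ) / n := by
  refine ⟨lowerDensity S / 2, by linarith, ?_⟩
  refine eventually_lt_of_lt_liminf (by unfold lowerDensity at *; linarith) ?_
  exact isBoundedUnder_of ⟨0, fun n => (dens_bdd S n).1⟩

lemma lowerDensity_pos_of_good {X : Type*} (f : X → X) {A B : Set X} (hAB : A ⊆ B) (y : X)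
    (h : ∃ δ > (0 : ℝ), ∀ n ≥ 1, δ * n < visS f A n y) : 0 < lowerDensity (visitsF f y B) := by
  obtain ⟨δ, hδ, h⟩ := h
  refine lowerDensity_pos_of_ev (c := δ / 2) (by positivity) ?_
  obtain ⟨K, hK⟩ := exists_nat_gt (2 / δ)
  filter_upwards [eventually_ge_atTop (K + 1)] with n hn
  have hn0 : (0 : ℝ) < n := by exact_mod_cast (by omega : 0 < n)
  rw [le_div_iff₀ hn0]
  have h1 := h n (by omega)
  have h2 := (vis_bounds f B n y).2
  have h3 := visS_mono f hAB n y
  rw [div_lt_iff₀ hδ] at hK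
  have : (K : ℝ) ≤ n := by exact_mod_cast (by omega : K ≤ n)
  nlinarith

section top
variable {X : Type*} [MetricSpace X]

lemma isClosed_omegaLimF (f : X → X) (x : X) : IsClosed (omegaLimF f x) := by
  rw [← closure_subset_iff_isClosed]
  intro y hy ε hε N
  obtain ⟨z, hz, hd⟩ := Metric.mem_closure_iff.1 hy (ε / 2) (by positivity)
  obtain ⟨n, hn, h⟩ := hz (ε / 2) (by positivity) N
  refine ⟨n, hn, ?_⟩
  have := dist_triangle (f^[n] x) z y
  rw [dist_comm] at hd
  linarith

lemma omegaLimF_inv {f : X → X} (hf : Continuous f) (x : X) {y : X} (hy : y ∈ omegaLimF f x) :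
    f y ∈ omegaLimF f x := by
  intro ε hε N
  obtain ⟨δ, hδ, h⟩ := Metric.continuous_iff.1 hf y ε hε
  obtain ⟨n, hn, hd⟩ := hy δ hδ N
  refine ⟨n + 1, by omega, ?_⟩
  rw [Function.iterate_succ_apply']
  exact h _ hd

lemma omegaLimF_iter {f : X → X} (hf : Continuous f) (x : X) {y : X} (hy : y ∈ omegaLimF f x)
    (n : ℕ) : f^[n] y ∈ omegaLimF f x := by
  induction n with
  | zero => exact hy
  | succ n ih => rw [Function.iterate_succ_apply']; exact omegaLimF_inv hf x ih

variable [CompactSpace X] [MeasurableSpace X] [BorelSpace X]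

lemma ae_wap {f : X → X} {μ : Measure X} [IsProbabilityMeasure μ] (hf : MeasurePreserving f μ μ) :
    ∀ᵐ y ∂μ, ∀ ε > (0 : ℝ), 0 < lowerDensity (visitsF f y (Metric.ball y ε)) := by
  have hB := TopologicalSpace.isBasis_countableBasis X
  have hall : ∀ᵐ y ∂μ, ∀ A ∈ TopologicalSpace.countableBasis X,
      y ∈ A → ∃ δ > (0 : ℝ), ∀ n ≥ 1, δ * n < visS f A n y := by
    rw [ae_ball_iff (TopologicalSpace.countable_countableBasis X)]
    intro A hA
    exact ae_good hf (hB.isOpen hA).measurableSet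
  filter_upwards [hall] with y hy ε hε
  obtain ⟨A, hA, hyA, hsub⟩ := hB.exists_subset_of_mem_open (Metric.mem_ball_self hε : y ∈ _)
    Metric.isOpen_ball
  exact lowerDensity_pos_of_good f hsub y (hy A hA hyA)

noncomputable def empMeas (f : X → X) (y : X) (n : ℕ) : Measure X :=
  ((n + 1 : ℕ) : ENNReal)⁻¹ • ∑ i ∈ Finset.range (n + 1), Measure.dirac (f^[i] y)

lemma empMeas_apply (f : X → X) (y : X) (n : ℕ) {A : Set X} (hA : MeasurableSet A) :
    empMeas f y n A = ENNReal.ofReal (visS f A (n + 1) y / (n + 1 : ℕ)) := by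
  have h0 : (0 : ℝ) < (n + 1 : ℕ) := by positivity
  have h1 : ∀ i, Measure.dirac (f^[i] y) A =
      ENNReal.ofReal (A.indicator (fun _ => (1 : ℝ)) (f^[i] y)) := by
    intro i
    rw [Measure.dirac_apply' _ hA]
    by_cases h : f^[i] y ∈ A <;> simp [h]
  rw [empMeas, Measure.smul_apply, Measure.finset_sum_apply, div_eq_inv_mul,
    ENNReal.ofReal_mul (by positivity), ENNReal.ofReal_inv_of_pos h0, ENNReal.ofReal_natCast,
    visS, ENNReal.ofReal_sum_of_nonneg, smul_eq_mul]
  · simp only [h1]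
  · exact fun i _ => Set.indicator_nonneg (fun _ _ => zero_le_one) _

lemma empMeas_prob (f : X → X) (y : X) (n : ℕ) : IsProbabilityMeasure (empMeas f y n) := by
  constructor
  rw [empMeas_apply _ _ _ MeasurableSet.univ]
  have h0 : ((n : ℝ) + 1) ≠ 0 := by positivity
  simp [visS, h0]

lemma empMeas_integral (f : X → X) (y : X) (n : ℕ) (g : BoundedContinuousFunction X ℝ) :
    ∫ z, g z ∂(empMeas f y n) = (∑ i ∈ Finset.range (n + 1), g (f^[i] y)) / (n + 1 : ℕ) := by
  rw [empMeas, integral_smul_measure, integral_finset_sum_measure]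
  · rw [ENNReal.toReal_inv, ENNReal.toReal_natCast, smul_eq_mul, div_eq_inv_mul]
    simp
  · intro i _
    exact g.integrable _

lemma exists_limit {f : X → X} (hf : Continuous f) (y : X) :
    ∃ μ : Measure X, IsProbabilityMeasure μ ∧ μ.map f = μ ∧
      ∀ F : Set X, IsClosed F → ∀ c : ENNReal, (∀ᶠ n in atTop, c ≤ empMeas f y n F) → c ≤ μ F := by
  let P : ℕ → ProbabilityMeasure X := fun n => ⟨empMeas f y n, empMeas_prob f y n⟩
  let U : Ultrafilter ℕ := hyperfilter ℕ
  have hU : (U : Filter ℕ) ≤ atTop := by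
    rw [← Nat.cofinite_eq_atTop]; exact hyperfilter_le_cofinite
  obtain ⟨μ, -, hμ⟩ := isCompact_univ.ultrafilter_le_nhds (U.map P) (by simp)
  have hlim : Tendsto P U (𝓝 μ) := hμ
  refine ⟨μ, inferInstance, ?_, ?_⟩
  · haveI : IsProbabilityMeasure ((μ : Measure X).map f) :=
      Measure.isProbabilityMeasure_map hf.measurable.aemeasurable
    refine ext_of_forall_integral_eq_of_IsFiniteMeasure fun g => ?_
    rw [integral_map hf.measurable.aemeasurable g.continuous.aestronglyMeasurable]
    have hT := ProbabilityMeasure.tendsto_iff_forall_integral_tendsto.1 hlim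
    have h1 := hT g
    have h2 := hT (g.compContinuous ⟨f, hf⟩)
    have h3 := h2.sub h1
    have h4 : Tendsto (fun n => ∫ z, (g.compContinuous ⟨f, hf⟩) z ∂(P n : Measure X) -
        ∫ z, g z ∂(P n : Measure X)) atTop (𝓝 0) := by
      have hz : Tendsto (fun n : ℕ => (2 * ‖g‖) / ((n : ℝ) + 1)) atTop (𝓝 0) := by
        have := (tendsto_one_div_add_atTop_nhds_zero_nat (𝕜 := ℝ)).const_mul (2 * ‖g‖)
        simpa [div_eq_mul_inv] using this
      refine squeeze_zero_norm (fun n => ?_) hz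
      simp only [P, ProbabilityMeasure.coe_mk]
      rw [empMeas_integral, empMeas_integral, ← sub_div, ← Finset.sum_sub_distrib]
      have : ∀ i, (g.compContinuous ⟨f, hf⟩) (f^[i] y) = g (f^[i+1] y) := by
        intro i; rw [Function.iterate_succ_apply']; rfl
      simp only [this]
      rw [Finset.sum_range_sub (fun i => g (f^[i] y)), norm_div]
      have hn : ‖((n + 1 : ℕ) : ℝ)‖ = (n : ℝ) + 1 := by
        rw [Real.norm_of_nonneg (by positivity)]; push_cast; rfl
      rw [hn]
      gcongr
      have a1 := norm_sub_le (g (f^[n+1] y)) (g (f^[0] y))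
      have a2 := g.norm_coe_le_norm (f^[n+1] y)
      have a3 := g.norm_coe_le_norm (f^[0] y)
      linarith
    have h5 := tendsto_nhds_unique h3 (h4.mono_left hU)
    simpa using sub_eq_zero.1 h5
  · intro F hF c hc
    have := ProbabilityMeasure.limsup_measure_closed_le_of_tendsto hlim hF
    refine le_trans ?_ this
    refine le_trans ?_ liminf_le_limsup
    exact le_liminf_of_le (by isBoundedDefault) (hU hc)
end top


/-- **Lemma (measure center).** Let `X` be a compact metric space, `f` continuous, `x ∈ X`,
and `Λ = ω_f(x)`. The measure center `C(Λ, f)` (the closure of the union of the supports of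
all invariant measures supported in `Λ`) equals the closure of the set of weakly almost
periodic points of `Λ`, i.e. of `{y ∈ Λ : d̲(N(y, B_ε(y))) > 0 for all ε > 0}`. -/
theorem measureCenter_eq_closure_weaklyAlmostPeriodic
    {X : Type*} [MetricSpace X] [CompactSpace X] [MeasurableSpace X] [BorelSpace X]
    (f : X → X) (hf : Continuous f) (x : X) :
    closure (⋃ μ ∈ invMeasuresOn f (omegaLimF f x), msuppX μ) =
      closure {y | y ∈ omegaLimF f x ∧
        ∀ ε > (0 : ℝ), 0 < lowerDensity (visitsF f y (Metric.ball y ε))} := by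
  apply subset_antisymm
  · apply closure_minimal _ isClosed_closure
    intro y hy
    simp only [Set.mem_iUnion, exists_prop] at hy
    obtain ⟨μ, ⟨hp, hinv, hΛ⟩, hy⟩ := hy
    rw [Metric.mem_closure_iff]
    intro ε hε
    have hmp : MeasurePreserving f μ μ := ⟨hf.measurable, hinv⟩
    have h1 := ae_wap hmp
    have h2 : ∀ᵐ z ∂μ, z ∈ omegaLimF f x :=
      (mem_ae_iff_prob_eq_one (isClosed_omegaLimF f x).measurableSet).2 hΛ
    have h3 : ∃ᵐ z ∂μ, z ∈ Metric.ball y ε :=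
      frequently_ae_mem_iff.2 (hy ε hε).ne'
    obtain ⟨z, hz, hz1, hz2⟩ := (h3.and_eventually (h1.and h2)).exists
    refine ⟨z, ⟨hz2, hz1⟩, ?_⟩
    rw [dist_comm]
    exact hz
  · apply closure_minimal _ isClosed_closure
    rintro y ⟨hy, hw⟩
    rw [Metric.mem_closure_iff]
    intro ε hε
    obtain ⟨μ, hp, hinv, hF⟩ := exists_limit hf y
    have hΛ : μ (omegaLimF f x) = 1 := by
      refine le_antisymm prob_le_one (hF _ (isClosed_omegaLimF f x) 1 (Eventually.of_forall ?_))
      intro n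
      rw [empMeas_apply _ _ _ (isClosed_omegaLimF f x).measurableSet]
      have h0 : ((n : ℝ) + 1) ≠ 0 := by positivity
      simp [visS, omegaLimF_iter hf x hy, h0]
    obtain ⟨c, hc, hev⟩ := ev_of_lowerDensity_pos (hw (ε / 2) (by positivity))
    have hK : ENNReal.ofReal c ≤ μ (Metric.closedBall y (ε / 2)) := by
      refine hF _ Metric.isClosed_closedBall _ ?_
      filter_upwards [(tendsto_add_atTop_nat 1).eventually hev] with n hn
      rw [empMeas_apply _ _ _ Metric.isClosed_closedBall.measurableSet]
      refine ENNReal.ofReal_le_ofReal (hn.le.trans ?_)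
      gcongr
      exact (vis_bounds f _ (n + 1) y).1.trans (visS_mono f Metric.ball_subset_closedBall _ _)
    have hne : μ (Metric.closedBall y (ε / 2)) ≠ 0 :=
      ((ENNReal.ofReal_pos.2 hc).trans_le hK).ne'
    obtain ⟨z, hz, hzs⟩ := exists_mem_forall_mem_nhdsWithin_pos_measure hne
    refine ⟨z, ?_, ?_⟩
    · simp only [Set.mem_iUnion, exists_prop]
      exact ⟨μ, ⟨hp, hinv, hΛ⟩, fun r hr =>
        hzs _ (mem_nhdsWithin_of_mem_nhds (Metric.ball_mem_nhds z hr))⟩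
    · rw [dist_comm]
      have := Metric.mem_closedBall.1 hz
      linarith
end

section
/- Let (X,d) be a compact metric space, f : X → X continuous, and x ∈ X with Λ = ω_f(x). Then: ω_{d̲}(x) = ∩_{μ ∈ V(x,f)} supp(μ); ω_{d̄}(x) = closure of ∪_{μ ∈ V(x,f)} supp(μ); ω_{B_*}(x) = ∩_{μ ∈ M(Λ,f)} supp(μ); and ω_{B*}(x) = closure of ∪_{μ ∈ M(Λ,f)} supp(μ) = C(Λ,f). -/
open Filter Topology MeasureTheory

noncomputable section Aux

def avA {X : Type*} (f : X → X) (g : X → ℝ) (z : X) (N : ℕ) : ℝ :=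
  (∑ i ∈ Finset.range N, g (f^[i] z)) / (N : ℝ)

def bump {X : Type*} [MetricSpace X] (y : X) (ε : ℝ) : C(X, ℝ) :=
  ⟨fun z => max 0 (1 - dist z y / ε), by fun_prop⟩

lemma bump_nonneg {X : Type*} [MetricSpace X] (y : X) (ε : ℝ) (z : X) : 0 ≤ bump y ε z :=
  le_max_left _ _

lemma bump_pos_iff {X : Type*} [MetricSpace X] (y : X) {ε : ℝ} (hε : 0 < ε) (z : X) :
    0 < bump y ε z ↔ z ∈ Metric.ball y ε := by
  simp only [bump, ContinuousMap.coe_mk, lt_max_iff, lt_irrefl, false_or, sub_pos, div_lt_one hε,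
    Metric.mem_ball]

lemma bump_le_one {X : Type*} [MetricSpace X] (y : X) {ε : ℝ} (hε : 0 < ε) (z : X) :
    bump y ε z ≤ 1 := by
  simp only [bump, ContinuousMap.coe_mk]
  have : 0 ≤ dist z y / ε := by positivity
  exact max_le (by norm_num) (by linarith)

lemma bump_half {X : Type*} [MetricSpace X] (y : X) {ε : ℝ} (hε : 0 < ε) (z : X)
    (hz : z ∈ Metric.ball y (ε / 2)) : 1 / 2 ≤ bump y ε z := by
  simp only [bump, ContinuousMap.coe_mk]
  refine le_max_of_le_right ?_
  have : dist z y / ε ≤ 1 / 2 := by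
    rw [div_le_iff₀ hε]
    have := Metric.mem_ball.1 hz
    linarith
  linarith

lemma bump_zero {X : Type*} [MetricSpace X] (y : X) {ε : ℝ} (hε : 0 < ε) (z : X)
    (hz : z ∉ Metric.ball y ε) : bump y ε z = 0 := by
  rw [← bump_pos_iff y hε] at hz
  exact le_antisymm (not_lt.1 hz) (bump_nonneg y ε z)

open Classical in
lemma ncard_eq_sum (S : Set ℕ) (a N : ℕ) :
    ((S ∩ Set.Ico a (a + N)).ncard : ℝ)
      = ∑ i ∈ Finset.range N, if a + i ∈ S then (1 : ℝ) else 0 := by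
  have h : (S ∩ Set.Ico a (a + N)) = ((Finset.Ico a (a + N)).filter (· ∈ S) : Finset ℕ) := by
    ext n; simp [and_comm]
  rw [h, Set.ncard_coe_finset, Finset.card_filter, Finset.sum_Ico_eq_sum_range]
  simp

lemma count_nonneg (S : Set ℕ) (a N : ℕ) : 0 ≤ ((S ∩ Set.Ico a (a + N)).ncard : ℝ) / N := by
  positivity

lemma count_le_one (S : Set ℕ) (a N : ℕ) : ((S ∩ Set.Ico a (a + N)).ncard : ℝ) / N ≤ 1 := by
  classical
  refine div_le_one_of_le₀ ?_ (by positivity)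
  rw [ncard_eq_sum]
  calc _ ≤ ∑ i ∈ Finset.range N, (1 : ℝ) := by
        apply Finset.sum_le_sum; intro i _; split_ifs <;> norm_num
    _ = N := by simp

lemma count_le_av {X : Type*} [MetricSpace X] (f : X → X) (x y : X) {ε : ℝ} (hε : 0 < ε)
    (a N : ℕ) :
    ((visitsF f x (Metric.ball y (ε / 2)) ∩ Set.Ico a (a + N)).ncard : ℝ) / N
      ≤ 2 * avA f (bump y ε) (f^[a] x) N := by
  classical
  rw [ncard_eq_sum, avA, ← mul_div_assoc, Finset.mul_sum]
  gcongr with i hi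
  rw [← Function.iterate_add_apply, add_comm i a]
  split_ifs with h
  · have := bump_half y hε _ h.2
    linarith
  · have := bump_nonneg y ε (f^[a + i] x)
    linarith

lemma av_le_count {X : Type*} [MetricSpace X] (f : X → X) (x y : X) {ε : ℝ} (hε : 0 < ε)
    (a N : ℕ) :
    avA f (bump y ε) (f^[a] x) N
      ≤ ((visitsF f x (Metric.ball y ε) ∩ Set.Ico a (a + N)).ncard : ℝ) / N + 1 / N := by
  classical
  rw [ncard_eq_sum, avA, ← add_div]
  gcongr
  have : (∑ i ∈ Finset.range N, if i = 0 then (1 : ℝ) else 0) ≤ 1 := by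
    rw [Finset.sum_ite_eq']; split_ifs <;> norm_num
  refine le_trans ?_ (add_le_add_right this _)
  rw [← Finset.sum_add_distrib]
  gcongr with i hi
  rw [← Function.iterate_add_apply, add_comm i a]
  have h1 := bump_le_one y hε (f^[a + i] x)
  by_cases h0 : i = 0
  · simp only [h0, if_true] at *
    split_ifs <;> linarith
  · by_cases hb : f^[a + i] x ∈ Metric.ball y ε
    · have : a + i ∈ visitsF f x (Metric.ball y ε) := ⟨by omega, hb⟩
      simp only [this, h0, if_true, if_false]; linarith
    · rw [bump_zero y hε _ hb]
      split_ifs <;> norm_num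

lemma liminf_pos_iff {u : ℕ → ℝ} (h0 : ∀ n, 0 ≤ u n) (h1 : ∀ n, u n ≤ 1) :
    0 < liminf u atTop ↔ ∃ c > 0, ∀ᶠ n in atTop, c ≤ u n := by
  have hb : IsBoundedUnder (· ≥ ·) atTop u := isBoundedUnder_of ⟨0, h0⟩
  have hb' : IsBoundedUnder (· ≤ ·) atTop u := isBoundedUnder_of ⟨1, h1⟩
  constructor
  · intro h
    refine ⟨liminf u atTop / 2, by linarith, ?_⟩
    exact (eventually_lt_of_lt_liminf (half_lt_self h) hb).mono fun _ h => h.le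
  · rintro ⟨c, hc, h⟩
    exact hc.trans_le (le_liminf_of_le hb'.isCoboundedUnder_ge h)

lemma limsup_pos_iff {u : ℕ → ℝ} (h0 : ∀ n, 0 ≤ u n) (h1 : ∀ n, u n ≤ 1) :
    0 < limsup u atTop ↔ ∃ c > 0, ∃ᶠ n in atTop, c ≤ u n := by
  have hb : IsBoundedUnder (· ≥ ·) atTop u := isBoundedUnder_of ⟨0, h0⟩
  have hb' : IsBoundedUnder (· ≤ ·) atTop u := isBoundedUnder_of ⟨1, h1⟩
  constructor
  · intro h
    refine ⟨limsup u atTop / 2, by linarith, ?_⟩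
    exact (frequently_lt_of_lt_limsup hb.isCoboundedUnder_le (half_lt_self h)).mono
      fun _ h => h.le
  · rintro ⟨c, hc, h⟩
    exact hc.trans_le (le_limsup_of_frequently_le h hb')

lemma lower_pos_iff (S : Set ℕ) : 0 < lowerDensity S ↔
    ∃ c > 0, ∀ᶠ N : ℕ in atTop, c ≤ ((S ∩ Set.Ico 0 (0 + N)).ncard : ℝ) / N := by
  rw [← liminf_pos_iff (fun N => count_nonneg S 0 N) (fun N => count_le_one S 0 N)]
  have : ∀ N : ℕ, Set.Ico 0 (0 + N) = Set.Iio N := fun N => by ext; simp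
  simp only [this, lowerDensity]

lemma upper_pos_iff (S : Set ℕ) : 0 < upperDensity S ↔
    ∃ c > 0, ∃ᶠ N : ℕ in atTop, c ≤ ((S ∩ Set.Ico 0 (0 + N)).ncard : ℝ) / N := by
  rw [← limsup_pos_iff (fun N => count_nonneg S 0 N) (fun N => count_le_one S 0 N)]
  have : ∀ N : ℕ, Set.Ico 0 (0 + N) = Set.Iio N := fun N => by ext; simp
  simp only [this, upperDensity]

lemma bLower_pos_iff (S : Set ℕ) : 0 < banachLowerDensity S ↔
    ∃ c > 0, ∀ᶠ N : ℕ in atTop, ∀ a : ℕ, c ≤ ((S ∩ Set.Ico a (a + N)).ncard : ℝ) / N := by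
  have hbd : ∀ N : ℕ, BddBelow (Set.range fun a : ℕ => ((S ∩ Set.Ico a (a + N)).ncard : ℝ) / N) :=
    fun N => ⟨0, by rintro _ ⟨a, rfl⟩; exact count_nonneg S a N⟩
  rw [banachLowerDensity, liminf_pos_iff (fun N => le_ciInf fun a => count_nonneg S a N)
    (fun N => (ciInf_le (hbd N) 0).trans (count_le_one S 0 N))]
  simp only [le_ciInf_iff (hbd _)]

lemma bUpper_pos_iff (S : Set ℕ) : 0 < banachUpperDensity S ↔
    ∃ c > 0, ∃ᶠ N : ℕ in atTop, ∃ a : ℕ, c ≤ ((S ∩ Set.Ico a (a + N)).ncard : ℝ) / N := by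
  have hbd : ∀ N : ℕ, BddAbove (Set.range fun a : ℕ => ((S ∩ Set.Ico a (a + N)).ncard : ℝ) / N) :=
    fun N => ⟨1, by rintro _ ⟨a, rfl⟩; exact count_le_one S a N⟩
  rw [banachUpperDensity, limsup_pos_iff
    (fun N => (count_nonneg S 0 N).trans (le_ciSup (hbd N) 0))
    (fun N => ciSup_le fun a => count_le_one S a N)]
  constructor
  · rintro ⟨c, hc, h⟩
    refine ⟨c / 2, by linarith, h.mono fun N hN => ?_⟩
    obtain ⟨a, ha⟩ := exists_lt_of_lt_ciSup (lt_of_lt_of_le (half_lt_self hc) hN)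
    exact ⟨a, ha.le⟩
  · rintro ⟨c, hc, h⟩
    exact ⟨c, hc, h.mono fun N ⟨a, ha⟩ => ha.trans (le_ciSup (hbd N) a)⟩

lemma ev_small {c : ℝ} (hc : 0 < c) : ∀ᶠ N : ℕ in atTop, 1 / (N : ℝ) ≤ c / 2 :=
  (tendsto_one_div_atTop_nhds_zero_nat.eventually (gt_mem_nhds (half_pos hc))).mono
    fun _ h => h.le

section
variable {X : Type*} [MetricSpace X] (f : X → X) (x y : X)

lemma mem_lower_iff : y ∈ statOmegaF lowerDensity f x ↔
    ∀ ε > 0, ∃ c > 0, ∀ᶠ N : ℕ in atTop, c ≤ avA f (bump y ε) x N := by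
  simp only [statOmegaF, Set.mem_setOf_eq, lower_pos_iff]
  constructor
  · intro h ε hε
    obtain ⟨c, hc, h⟩ := h (ε / 2) (by linarith)
    refine ⟨c / 2, by linarith, h.mono fun N hN => ?_⟩
    have := count_le_av f x y hε 0 N
    simp only [Function.iterate_zero, id] at this
    linarith
  · intro h ε hε
    obtain ⟨c, hc, h⟩ := h ε hε
    refine ⟨c / 2, by linarith, ?_⟩
    filter_upwards [h, ev_small hc] with N hN hs
    have := av_le_count f x y hε 0 N
    simp only [Function.iterate_zero, id] at this
    linarith

lemma mem_upper_iff : y ∈ statOmegaF upperDensity f x ↔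
    ∀ ε > 0, ∃ c > 0, ∃ᶠ N : ℕ in atTop, c ≤ avA f (bump y ε) x N := by
  simp only [statOmegaF, Set.mem_setOf_eq, upper_pos_iff]
  constructor
  · intro h ε hε
    obtain ⟨c, hc, h⟩ := h (ε / 2) (by linarith)
    refine ⟨c / 2, by linarith, h.mono fun N hN => ?_⟩
    have := count_le_av f x y hε 0 N
    simp only [Function.iterate_zero, id] at this
    linarith
  · intro h ε hε
    obtain ⟨c, hc, h⟩ := h ε hε
    refine ⟨c / 2, by linarith, (h.and_eventually (ev_small hc)).mono ?_⟩
    rintro N ⟨hN, hs⟩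
    have := av_le_count f x y hε 0 N
    simp only [Function.iterate_zero, id] at this
    linarith

lemma mem_bLower_iff : y ∈ statOmegaF banachLowerDensity f x ↔
    ∀ ε > 0, ∃ c > 0, ∀ᶠ N : ℕ in atTop, ∀ a, c ≤ avA f (bump y ε) (f^[a] x) N := by
  simp only [statOmegaF, Set.mem_setOf_eq, bLower_pos_iff]
  constructor
  · intro h ε hε
    obtain ⟨c, hc, h⟩ := h (ε / 2) (by linarith)
    refine ⟨c / 2, by linarith, h.mono fun N hN a => ?_⟩
    have := count_le_av f x y hε a N
    linarith [hN a]
  · intro h ε hε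
    obtain ⟨c, hc, h⟩ := h ε hε
    refine ⟨c / 2, by linarith, ?_⟩
    filter_upwards [h, ev_small hc] with N hN hs a
    have := av_le_count f x y hε a N
    linarith [hN a]

lemma mem_bUpper_iff : y ∈ statOmegaF banachUpperDensity f x ↔
    ∀ ε > 0, ∃ c > 0, ∃ᶠ N : ℕ in atTop, ∃ a, c ≤ avA f (bump y ε) (f^[a] x) N := by
  simp only [statOmegaF, Set.mem_setOf_eq, bUpper_pos_iff]
  constructor
  · intro h ε hε
    obtain ⟨c, hc, h⟩ := h (ε / 2) (by linarith)
    refine ⟨c / 2, by linarith, h.mono ?_⟩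
    rintro N ⟨a, hN⟩
    have := count_le_av f x y hε a N
    exact ⟨a, by linarith⟩
  · intro h ε hε
    obtain ⟨c, hc, h⟩ := h ε hε
    refine ⟨c / 2, by linarith, (h.and_eventually (ev_small hc)).mono ?_⟩
    rintro N ⟨⟨a, hN⟩, hs⟩
    have := av_le_count f x y hε a N
    exact ⟨a, by linarith⟩

end

section
variable {X : Type*} [MetricSpace X] [CompactSpace X] [MeasurableSpace X] [BorelSpace X]

lemma integrable_cont (μ : Measure X) [IsProbabilityMeasure μ] {g : X → ℝ} (hg : Continuous g) :
    Integrable g μ :=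
  hg.integrable_of_hasCompactSupport (HasCompactSupport.of_compactSpace g)

lemma bump_int_pos_iff (μ : Measure X) [IsProbabilityMeasure μ] (y : X) {ε : ℝ} (hε : 0 < ε) :
    0 < ∫ z, bump y ε z ∂μ ↔ 0 < μ (Metric.ball y ε) := by
  rw [integral_pos_iff_support_of_nonneg (fun z => bump_nonneg y ε z)
    (integrable_cont μ (bump y ε).continuous)]
  have : Function.support (bump y ε) = Metric.ball y ε := by
    ext z
    rw [← bump_pos_iff y hε, Function.mem_support]
    exact ⟨fun h => lt_of_le_of_ne (bump_nonneg y ε z) h.symm, fun h => h.ne'⟩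
  rw [this]

lemma msupp_eq (μ : Measure X) : msuppX μ = μ.support := by
  ext y
  rw [Metric.nhds_basis_ball.mem_measureSupport]
  rfl

lemma mem_msupp_iff (μ : Measure X) [IsProbabilityMeasure μ] (y : X) :
    y ∈ msuppX μ ↔ ∀ ε > 0, 0 < ∫ z, bump y ε z ∂μ :=
  forall₂_congr fun ε hε => (bump_int_pos_iff μ y hε).symm

/-- `y` in the closure of the union of supports. -/
lemma mem_closure_iff_bump (M : Set (Measure X)) (hM : ∀ μ ∈ M, IsProbabilityMeasure μ) (y : X) :
    y ∈ closure (⋃ μ ∈ M, msuppX μ) ↔ ∀ ε > 0, ∃ μ ∈ M, 0 < ∫ z, bump y ε z ∂μ := by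
  rw [Metric.mem_closure_iff]
  refine forall₂_congr fun ε hε => ?_
  constructor
  · rintro ⟨w, hw, hd⟩
    simp only [Set.mem_iUnion] at hw
    obtain ⟨μ, hμ, hw⟩ := hw
    have := hM μ hμ
    refine ⟨μ, hμ, (bump_int_pos_iff μ y hε).2 ?_⟩
    refine (hw (ε - dist y w) (by linarith)).trans_le (measure_mono ?_)
    apply Metric.ball_subset_ball'
    rw [dist_comm w y]; linarith
  · rintro ⟨μ, hμ, h⟩
    have := hM μ hμ
    rw [bump_int_pos_iff μ y hε] at h
    obtain ⟨w, hw, hs⟩ := Measure.nonempty_inter_support_of_pos h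
    refine ⟨w, ?_, by rw [dist_comm]; exact hw⟩
    simp only [Set.mem_iUnion]
    exact ⟨μ, hμ, by rw [msupp_eq]; exact hs⟩

lemma exists_emp (f : X → X) (z : X) (N : ℕ) (hN : 0 < N) :
    ∃ ν : ProbabilityMeasure X, ∀ g : C(X, ℝ), ∫ w, g w ∂(ν : Measure X) = avA f g z N := by
  let ν : Measure X := ((N : ENNReal)⁻¹) • ∑ i ∈ Finset.range N, Measure.dirac (f^[i] z)
  have hp : IsProbabilityMeasure ν := by
    constructor
    simp only [ν, Measure.smul_apply, Measure.finsetSum_apply, measure_univ, Finset.sum_const,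
      Finset.card_range, smul_eq_mul, nsmul_eq_mul, mul_one]
    exact ENNReal.inv_mul_cancel (by exact_mod_cast hN.ne') (ENNReal.natCast_ne_top N)
  refine ⟨⟨ν, hp⟩, fun g => ?_⟩
  show ∫ w, g w ∂ν = _
  rw [integral_smul_measure, integral_finsetSum_measure
    (fun i _ => integrable_cont _ g.continuous)]
  simp only [integral_dirac, avA, ENNReal.toReal_inv, ENNReal.toReal_natCast, smul_eq_mul]
  rw [div_eq_inv_mul]

lemma exists_limit_s5 (f : X → X) (z : ℕ → X) (n : ℕ → ℕ) (hn : ∀ k, 0 < n k) :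
    ∃ μ : Measure X, IsProbabilityMeasure μ ∧ ∃ ψ : ℕ → ℕ, StrictMono ψ ∧
      ∀ g : C(X, ℝ), Tendsto (fun k => avA f g (z (ψ k)) (n (ψ k))) atTop (𝓝 (∫ w, g w ∂μ)) := by
  choose ν hν using fun k => exists_emp f (z k) (n k) (hn k)
  obtain ⟨μ, ψ, hψ, h⟩ := CompactSpace.tendsto_subseq ν
  refine ⟨μ, inferInstance, ψ, hψ, fun g => ?_⟩
  rw [ProbabilityMeasure.tendsto_iff_forall_integral_tendsto] at h
  have := h (BoundedContinuousFunction.mkOfCompact g)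
  simpa [hν] using this

lemma orbit_infDist (f : X → X) (x : X) :
    (omegaLimF f x).Nonempty ∧ IsClosed (omegaLimF f x) ∧
    ∀ ε > 0, ∃ n0, ∀ n ≥ n0, Metric.infDist (f^[n] x) (omegaLimF f x) ≤ ε := by
  have key : ∀ φ : ℕ → ℕ, StrictMono φ → ∃ w ∈ omegaLimF f x, ∃ ψ : ℕ → ℕ, StrictMono ψ ∧
      Tendsto (fun k => f^[φ (ψ k)] x) atTop (𝓝 w) := by
    intro φ hφ
    obtain ⟨w, ψ, hψ, h⟩ := CompactSpace.tendsto_subseq (fun k => f^[φ k] x)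
    refine ⟨w, fun ε hε N => ?_, ψ, hψ, h⟩
    have h1 := h.eventually (Metric.ball_mem_nhds w hε)
    have h2 := (hφ.comp hψ).tendsto_atTop.eventually (eventually_ge_atTop N)
    obtain ⟨k, hk1, hk2⟩ := (h1.and h2).exists
    exact ⟨_, hk2, hk1⟩
  refine ⟨?_, ?_, ?_⟩
  · obtain ⟨w, hw, _⟩ := key id strictMono_id
    exact ⟨w, hw⟩
  · rw [← closure_subset_iff_isClosed]
    intro w hw ε hε N
    obtain ⟨v, hv, hd⟩ := Metric.mem_closure_iff.1 hw (ε / 2) (by linarith)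
    obtain ⟨n, hn, hd2⟩ := hv (ε / 2) (by linarith) N
    refine ⟨n, hn, ?_⟩
    have := dist_triangle (f^[n] x) v w
    rw [dist_comm v w] at this
    linarith
  · intro ε hε
    by_contra! hcon
    have hfr : ∃ᶠ n in atTop, ε < Metric.infDist (f^[n] x) (omegaLimF f x) :=
      frequently_atTop.2 hcon
    obtain ⟨φ, hφ, hh⟩ := extraction_of_frequently_atTop hfr
    obtain ⟨w, hw, ψ, hψ, hlim⟩ := key φ hφ
    obtain ⟨k, hk⟩ := (hlim.eventually (Metric.ball_mem_nhds w hε)).exists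
    have := Metric.infDist_le_dist_of_mem (x := f^[φ (ψ k)] x) hw
    have h3 := hh (ψ k)
    have h4 : dist (f^[φ (ψ k)] x) w < ε := hk
    linarith

lemma limit_mem (f : X → X) (hf : Continuous f) (x : X) (a n : ℕ → ℕ)
    (hn : Tendsto n atTop atTop) (μ : Measure X) [IsProbabilityMeasure μ]
    (h : ∀ g : C(X, ℝ), Tendsto (fun k => avA f g (f^[a k] x) (n k)) atTop (𝓝 (∫ w, g w ∂μ))) :
    μ ∈ invMeasuresOn f (omegaLimF f x) := by
  have hn' : Tendsto (fun k => (1 : ℝ) / (n k : ℝ)) atTop (𝓝 0) :=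
    tendsto_one_div_atTop_nhds_zero_nat.comp hn
  refine ⟨inferInstance, ?_, ?_⟩
  · have : IsProbabilityMeasure (μ.map f) := Measure.isProbabilityMeasure_map hf.aemeasurable
    apply ext_of_forall_integral_eq_of_IsFiniteMeasure
    intro g
    rw [integral_map hf.aemeasurable g.continuous.aestronglyMeasurable]
    let g0 : C(X, ℝ) := g.toContinuousMap
    let g1 : C(X, ℝ) := g0.comp ⟨f, hf⟩
    have h0 := h g0
    have h1 := h g1
    have hd : Tendsto (fun k => avA f g1 (f^[a k] x) (n k) - avA f g0 (f^[a k] x) (n k))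
        atTop (𝓝 0) := by
      have hlim : Tendsto (fun k => 2 * ‖g‖ * ((1 : ℝ) / (n k : ℝ))) atTop (𝓝 0) := by
        simpa using hn'.const_mul (2 * ‖g‖)
      refine squeeze_zero_norm (fun k => ?_) hlim
      have e : avA f g1 (f^[a k] x) (n k) - avA f g0 (f^[a k] x) (n k)
          = (g (f^[n k] (f^[a k] x)) - g (f^[a k] x)) * (1 / (n k : ℝ)) := by
        simp only [avA]
        rw [← sub_div, ← Finset.sum_sub_distrib, div_eq_mul_one_div]
        congr 1
        have := Finset.sum_range_sub (fun i => g (f^[i] (f^[a k] x))) (n k)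
        simp only [Function.iterate_zero, id] at this
        rw [← this]
        refine Finset.sum_congr rfl fun i _ => ?_
        rw [Function.iterate_succ_apply']
        rfl
      rw [e, norm_mul]
      have h2 := norm_sub_le (g (f^[n k] (f^[a k] x))) (g (f^[a k] x))
      have h3 := g.norm_coe_le_norm (f^[n k] (f^[a k] x))
      have h4 := g.norm_coe_le_norm (f^[a k] x)
      have h5 : ‖(1 : ℝ) / (n k : ℝ)‖ = 1 / (n k : ℝ) := Real.norm_of_nonneg (by positivity)
      rw [h5]
      gcongr
      linarith
    have h6 := tendsto_nhds_unique hd (h1.sub h0)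
    have h7 : ∫ w, g (f w) ∂μ - ∫ w, g w ∂μ = 0 := h6.symm
    linarith
  · obtain ⟨hne, hcl, hd⟩ := orbit_infDist f x
    let g : C(X, ℝ) := ⟨fun z => Metric.infDist z (omegaLimF f x), Metric.continuous_infDist_pt _⟩
    have hg0 : ∀ z, 0 ≤ g z := fun z => Metric.infDist_nonneg
    have hle : ∫ w, g w ∂μ ≤ 0 := by
      refine le_of_forall_pos_le_add fun ε hε => ?_
      rw [zero_add]
      obtain ⟨n0, hn0⟩ := hd ε hε
      have hlim : Tendsto (fun k => ε + n0 * ‖g‖ * ((1 : ℝ) / (n k : ℝ))) atTop (𝓝 ε) := by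
        simpa using (hn'.const_mul (n0 * ‖g‖)).const_add ε
      refine le_of_tendsto_of_tendsto (h g) hlim ?_
      filter_upwards [hn.eventually_gt_atTop 0] with k hk
      have hk' : (0 : ℝ) < n k := by exact_mod_cast hk
      simp only [avA]
      rw [div_le_iff₀ hk']
      have e : (ε + n0 * ‖g‖ * (1 / (n k : ℝ))) * n k = n k * ε + n0 * ‖g‖ := by
        field_simp
      rw [e]
      have hs : ∑ i ∈ Finset.range (n k), (if i < n0 then ‖g‖ else 0) ≤ n0 * ‖g‖ := by
        rw [← Finset.sum_filter, Finset.sum_const, nsmul_eq_mul]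
        gcongr
        calc _ ≤ (Finset.range n0).card := by
              apply Finset.card_le_card; intro i; simp
          _ = n0 := by simp
      refine le_trans ?_ (add_le_add_right hs _)
      have e2 : (n k : ℝ) * ε = ∑ i ∈ Finset.range (n k), ε := by simp
      rw [e2, ← Finset.sum_add_distrib]
      refine Finset.sum_le_sum fun i _ => ?_
      split_ifs with hi
      · have := (le_abs_self _).trans (g.norm_coe_le_norm (f^[i] (f^[a k] x)))
        linarith
      · rw [← Function.iterate_add_apply]
        have := hn0 (i + a k) (by omega)
        rw [add_zero]
        exact this
    have h0 : ∫ w, g w ∂μ = 0 := le_antisymm hle (integral_nonneg hg0)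
    rw [integral_eq_zero_iff_of_nonneg hg0 (integrable_cont μ g.continuous)] at h0
    have hae : ∀ᵐ z ∂μ, z ∈ omegaLimF f x := by
      filter_upwards [h0] with z hz
      exact (hcl.mem_iff_infDist_zero hne).2 hz
    rw [prob_compl_eq_zero_iff hcl.measurableSet |>.symm]
    exact hae

lemma avA_cont (f : X → X) (hf : Continuous f) (g : C(X, ℝ)) (N : ℕ) :
    Continuous (fun z => avA f g z N) := by
  unfold avA
  refine Continuous.div_const (continuous_finsetSum _ fun i _ => ?_) _
  exact g.continuous.comp (hf.iterate i)

lemma avA_integral (f : X → X) (hf : Continuous f) (g : C(X, ℝ)) (N : ℕ) (hN : 0 < N)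
    (μ : Measure X) [IsProbabilityMeasure μ] (hμ : μ.map f = μ) :
    ∫ z, avA f g z N ∂μ = ∫ z, g z ∂μ := by
  have hN' : (N : ℝ) ≠ 0 := by exact_mod_cast hN.ne'
  have hmp : MeasurePreserving f μ μ := ⟨hf.measurable, hμ⟩
  have hi : ∀ i, ∫ z, g (f^[i] z) ∂μ = ∫ z, g z ∂μ := by
    intro i
    have h := (hmp.iterate i)
    conv_rhs => rw [← h.map_eq]
    rw [integral_map h.measurable.aemeasurable g.continuous.aestronglyMeasurable]
  unfold avA
  rw [integral_div, integral_finsetSum _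
    (fun i _ => integrable_cont μ (g := fun z => g (f^[i] z))
      (g.continuous.comp (hf.iterate i)))]
  simp only [hi]
  simp
  field_simp

lemma omega_sub_closure (f : X → X) (x z : X) (hz : z ∈ omegaLimF f x) :
    z ∈ closure (Set.range fun a : ℕ => f^[a] x) := by
  rw [Metric.mem_closure_iff]
  intro ε hε
  obtain ⟨n, _, h⟩ := hz ε hε 0
  exact ⟨_, ⟨n, rfl⟩, by rw [dist_comm]; exact h⟩

lemma ae_omega (f : X → X) (x : X) (μ : Measure X)
    (hμ : μ ∈ invMeasuresOn f (omegaLimF f x)) : ∀ᵐ z ∂μ, z ∈ omegaLimF f x := by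
  have := hμ.1
  have h := hμ.2.2
  rw [← prob_compl_eq_zero_iff (orbit_infDist f x).2.1.measurableSet] at h
  exact h

end

end Aux

/-- **Lemma (statistical ω-limit sets via measures).** For a compact metric space `X`,
`f` continuous and `x ∈ X` with `Λ = ω_f(x)`:
`ω_{d̲}(x) = ⋂_{μ ∈ V(x,f)} supp μ`, `ω_{d̄}(x) = closure (⋃_{μ ∈ V(x,f)} supp μ)`,
`ω_{B_*}(x) = ⋂_{μ ∈ M(Λ,f)} supp μ`, and
`ω_{B*}(x) = closure (⋃_{μ ∈ M(Λ,f)} supp μ) = C(Λ, f)`. -/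
theorem statOmega_eq_supports
    {X : Type*} [MetricSpace X] [CompactSpace X] [MeasurableSpace X] [BorelSpace X]
    (f : X → X) (hf : Continuous f) (x : X) :
    statOmegaF lowerDensity f x = ⋂ μ ∈ VSetX f x, msuppX μ ∧
    statOmegaF upperDensity f x = closure (⋃ μ ∈ VSetX f x, msuppX μ) ∧
    statOmegaF banachLowerDensity f x = ⋂ μ ∈ invMeasuresOn f (omegaLimF f x), msuppX μ ∧
    statOmegaF banachUpperDensity f x =
      closure (⋃ μ ∈ invMeasuresOn f (omegaLimF f x), msuppX μ) := by
  have hpos : ∀ φ : ℕ → ℕ, StrictMono φ → ∀ k, 0 < φ (k + 1) := fun φ hφ k =>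
    lt_of_le_of_lt (Nat.zero_le _) (hφ (Nat.lt_succ_self k))
  have hs : StrictMono (fun k : ℕ => k + 1) := fun _ _ h => Nat.succ_lt_succ h
  have h1k : Tendsto (fun k : ℕ => (1 : ℝ) / ((k : ℝ) + 1)) atTop (𝓝 0) :=
    tendsto_one_div_add_atTop_nhds_zero_nat
  refine ⟨?_, ?_, ?_, ?_⟩
  · ext y
    rw [mem_lower_iff]
    simp only [Set.mem_iInter]
    constructor
    · rintro h μ ⟨hμ, φ, hφ, hg⟩
      rw [mem_msupp_iff]
      intro ε hε
      obtain ⟨c, hc, hev⟩ := h ε hε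
      exact hc.trans_le (ge_of_tendsto (hg (bump y ε)) (hφ.tendsto_atTop.eventually hev))
    · intro h
      by_contra! hcon
      obtain ⟨ε, hε, hcon⟩ := hcon
      have hfr : ∀ k : ℕ, ∃ᶠ N : ℕ in atTop, avA f (bump y ε) x N < 1 / ((k : ℝ) + 1) := by
        intro k
        have := hcon (1 / ((k : ℝ) + 1)) (by positivity)
        simpa using this
      obtain ⟨φ, hφ, hlt⟩ := extraction_forall_of_frequently hfr
      obtain ⟨μ, hμ, ψ, hψ, hlim⟩ := exists_limit_s5 f (fun _ => x) (fun k => φ (k + 1)) (hpos φ hφ)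
      have hV : μ ∈ VSetX f x := ⟨hμ, fun k => φ (ψ k + 1), hφ.comp (hs.comp hψ), hlim⟩
      have h1 := (mem_msupp_iff μ y).1 (h μ hV) ε hε
      have h2 : ∫ z, bump y ε z ∂μ ≤ 0 :=
        le_of_tendsto_of_tendsto' (hlim (bump y ε))
          (h1k.comp (hs.comp hψ).tendsto_atTop) fun k => (hlt (ψ k + 1)).le
      linarith
  · ext y
    rw [mem_upper_iff, mem_closure_iff_bump _ (fun μ hμ => hμ.1)]
    refine forall₂_congr fun ε hε => ?_
    constructor
    · rintro ⟨c, hc, hfr⟩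
      obtain ⟨φ, hφ, hlt⟩ := extraction_of_frequently_atTop hfr
      obtain ⟨μ, hμ, ψ, hψ, hlim⟩ := exists_limit_s5 f (fun _ => x) (fun k => φ (k + 1)) (hpos φ hφ)
      have hV : μ ∈ VSetX f x := ⟨hμ, fun k => φ (ψ k + 1), hφ.comp (hs.comp hψ), hlim⟩
      exact ⟨μ, hV, hc.trans_le (ge_of_tendsto' (hlim (bump y ε)) fun k => hlt _)⟩
    · rintro ⟨μ, ⟨hμ, φ, hφ, hg⟩, hI⟩
      refine ⟨(∫ z, bump y ε z ∂μ) / 2, by linarith, ?_⟩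
      have := (hg (bump y ε)).eventually (lt_mem_nhds (half_lt_self hI))
      exact hφ.tendsto_atTop.frequently (this.frequently.mono fun j hj => hj.le)
  · ext y
    rw [mem_bLower_iff]
    simp only [Set.mem_iInter]
    constructor
    · rintro h μ hμ
      have := hμ.1
      rw [mem_msupp_iff]
      intro ε hε
      obtain ⟨c, hc, hev⟩ := h ε hε
      obtain ⟨N, hN, hN0⟩ := (hev.and (eventually_gt_atTop 0)).exists
      rw [← avA_integral f hf (bump y ε) N hN0 μ hμ.2.1]
      have hcl : IsClosed {z | c ≤ avA f (bump y ε) z N} :=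
        isClosed_le continuous_const (avA_cont f hf _ N)
      have hsub : closure (Set.range fun a : ℕ => f^[a] x) ⊆ {z | c ≤ avA f (bump y ε) z N} :=
        closure_minimal (by rintro _ ⟨a, rfl⟩; exact hN a) hcl
      have : ∫ z, c ∂μ ≤ ∫ z, avA f (bump y ε) z N ∂μ := by
        refine integral_mono_ae (integrable_const c) (integrable_cont μ (avA_cont f hf _ N)) ?_
        filter_upwards [ae_omega f x μ hμ] with z hz
        exact hsub (omega_sub_closure f x z hz)
      simp at this
      linarith
    · intro h
      by_contra! hcon
      obtain ⟨ε, hε, hcon⟩ := hcon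
      have hfr : ∀ k : ℕ, ∃ᶠ N : ℕ in atTop, ∃ a,
          avA f (bump y ε) (f^[a] x) N < 1 / ((k : ℝ) + 1) := by
        intro k
        have := hcon (1 / ((k : ℝ) + 1)) (by positivity)
        simpa using this
      obtain ⟨φ, hφ, hlt⟩ := extraction_forall_of_frequently hfr
      choose a hlt using hlt
      obtain ⟨μ, hμ, ψ, hψ, hlim⟩ :=
        exists_limit_s5 f (fun k => f^[a (k + 1)] x) (fun k => φ (k + 1)) (hpos φ hφ)
      have hV := limit_mem f hf x (fun k => a (ψ k + 1)) (fun k => φ (ψ k + 1))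
        (hφ.comp (hs.comp hψ)).tendsto_atTop μ hlim
      have h1 := (mem_msupp_iff μ y).1 (h μ hV) ε hε
      have h2 : ∫ z, bump y ε z ∂μ ≤ 0 :=
        le_of_tendsto_of_tendsto' (hlim (bump y ε))
          (h1k.comp (hs.comp hψ).tendsto_atTop) fun k => (hlt (ψ k + 1)).le
      linarith
  · ext y
    rw [mem_bUpper_iff, mem_closure_iff_bump _ (fun μ hμ => hμ.1)]
    refine forall₂_congr fun ε hε => ?_
    constructor
    · rintro ⟨c, hc, hfr⟩
      obtain ⟨φ, hφ, hlt⟩ := extraction_of_frequently_atTop hfr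
      choose a hlt using hlt
      obtain ⟨μ, hμ, ψ, hψ, hlim⟩ :=
        exists_limit_s5 f (fun k => f^[a (k + 1)] x) (fun k => φ (k + 1)) (hpos φ hφ)
      have hV := limit_mem f hf x (fun k => a (ψ k + 1)) (fun k => φ (ψ k + 1))
        (hφ.comp (hs.comp hψ)).tendsto_atTop μ hlim
      exact ⟨μ, hV, hc.trans_le (ge_of_tendsto' (hlim (bump y ε)) fun k => hlt _)⟩
    · rintro ⟨μ, hμ, hI⟩
      have := hμ.1
      refine ⟨(∫ z, bump y ε z ∂μ) / 2, by linarith, ?_⟩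
      refine ((eventually_gt_atTop 0).mono fun N hN0 => ?_).frequently
      by_contra! hcon
      have hcl : IsClosed {z | avA f (bump y ε) z N ≤ (∫ z, bump y ε z ∂μ) / 2} :=
        isClosed_le (avA_cont f hf _ N) continuous_const
      have hsub : closure (Set.range fun a : ℕ => f^[a] x) ⊆
          {z | avA f (bump y ε) z N ≤ (∫ z, bump y ε z ∂μ) / 2} :=
        closure_minimal (by rintro _ ⟨a, rfl⟩; exact (hcon a).le) hcl
      have h2 : ∫ z, avA f (bump y ε) z N ∂μ ≤ ∫ w, (∫ z, bump y ε z ∂μ) / 2 ∂μ := by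
        refine integral_mono_ae (integrable_cont μ (avA_cont f hf _ N)) (integrable_const _) ?_
        filter_upwards [ae_omega f x μ hμ] with z hz
        exact hsub (omega_sub_closure f x z hz)
      rw [avA_integral f hf (bump y ε) N hN0 μ hμ.2.1] at h2
      simp only [integral_const, probReal_univ, one_smul] at h2
      linarith
end
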